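/- Post-collapse limit of the coefficient statistic (displayed limit in the proof of Theorem 4). Under the bubble model with Assumptions A1 and A2 and the initial-value condition, for every fixed r with r_f < r ≤ 1, the coefficient statistic SV-ADF^δ_{⌊nr⌋} = ⌊nr⌋·(δ̂(⌊nr⌋) − 1) converges in probability, as n → ∞, to the finite constant r²·(1/2 − a)/( r_f·(r − r_f) ), where a := (r − r_f)/r; in particular, beyond the collapse date the statistic is bounded in probability rather than divergent. -/

import Mathlib

open MeasureTheory ProbabilityTheory Filter

/-- The average innovation variance `m_{n,k} = k⁻¹ Σ_{t=1}^k E[σ_t²]`. -/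
noncomputable def avgVar {Ω : Type*} [MeasurableSpace Ω] (P : ℕ → Measure Ω)
    (σ : ℕ → ℕ → Ω → ℝ) (n k : ℕ) : ℝ :=
  (∑ t ∈ Finset.Icc 1 k, ∫ ω, (σ n t ω) ^ 2 ∂(P n)) / k

/-- Recursive sample mean `X̄_τ = τ⁻¹ Σ_{k=1}^τ X_{k-1}`. -/
noncomputable def xbar {Ω : Type*} (X : ℕ → Ω → ℝ) (τ : ℕ) (ω : Ω) : ℝ :=
  (∑ k ∈ Finset.Icc 1 τ, X (k - 1) ω) / τ

/-- Demeaned observation `X̃_j = X_j - X̄_τ`. -/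
noncomputable def xtil {Ω : Type*} (X : ℕ → Ω → ℝ) (τ j : ℕ) (ω : Ω) : ℝ :=
  X j ω - xbar X τ ω

/-- OLS slope `δ̂(τ) = (Σ_{j=1}^τ X̃_{j-1} X_j)/(Σ_{j=1}^τ X̃_{j-1}²)`. -/
noncomputable def deltaHat {Ω : Type*} (X : ℕ → Ω → ℝ) (τ : ℕ) (ω : Ω) : ℝ :=
  (∑ j ∈ Finset.Icc 1 τ, xtil X τ (j - 1) ω * X j ω) /
    ∑ j ∈ Finset.Icc 1 τ, (xtil X τ (j - 1) ω) ^ 2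

/-- Coefficient-based recursive statistic `SV-ADF^δ_τ = τ (δ̂(τ) - 1)`. -/
noncomputable def svadfDelta {Ω : Type*} (X : ℕ → Ω → ℝ) (τ : ℕ) (ω : Ω) : ℝ :=
  (τ : ℝ) * (deltaHat X τ ω - 1)


/-- The filter of events whose probability tends to one. -/
def pfil {Ω : Type*} [MeasurableSpace Ω] (P : ℕ → Measure Ω) : Filter (ℕ × Ω) where
  sets := {S | Tendsto (fun n => P n {ω | (n, ω) ∉ S}) atTop (nhds 0)}
  univ_sets := by simp
  sets_of_superset := by
    intro S T hS hST
    refine tendsto_of_tendsto_of_tendsto_of_le_of_le tendsto_const_nhds hS (fun _ => zero_le) ?_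
    intro n
    exact measure_mono (fun ω hω h => hω (hST h))
  inter_sets := by
    intro S T hS hT
    have h := Tendsto.add hS hT
    rw [add_zero] at h
    refine tendsto_of_tendsto_of_tendsto_of_le_of_le tendsto_const_nhds h (fun _ => zero_le) ?_
    intro n
    refine le_trans (measure_mono ?_) (measure_union_le _ _)
    intro ω hω
    by_cases h1 : (n, ω) ∈ S
    · right
      intro h2
      exact hω ⟨h1, h2⟩
    · left
      exact h1

lemma mem_pfil {Ω : Type*} [MeasurableSpace Ω] (P : ℕ → Measure Ω) (S : Set (ℕ × Ω)) :
    S ∈ pfil P ↔ Tendsto (fun n => P n {ω | (n, ω) ∉ S}) atTop (nhds 0) := Iff.rfl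

lemma pfil_fst {Ω : Type*} [MeasurableSpace Ω] (P : ℕ → Measure Ω) :
    Tendsto Prod.fst (pfil P) atTop := by
  intro S hS
  rw [Filter.mem_map, mem_pfil]
  refine tendsto_const_nhds.congr' ?_
  filter_upwards [hS] with n hn
  simp [hn]

lemma pfil_tendsto_iff {Ω : Type*} [MeasurableSpace Ω] (P : ℕ → Measure Ω) (f : ℕ → Ω → ℝ)
    (c : ℝ) : Tendsto (fun p : ℕ × Ω => f p.1 p.2) (pfil P) (nhds c) ↔
      ∀ e : ℝ, 0 < e → Tendsto (fun n => P n {ω | e ≤ |f n ω - c|}) atTop (nhds 0) := by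
  rw [Metric.tendsto_nhds]
  constructor
  · intro h e he
    have := h e he
    rw [Filter.Eventually, mem_pfil] at this
    simpa [Real.dist_eq] using this
  · intro h e he
    rw [Filter.Eventually, mem_pfil]
    simpa [Real.dist_eq] using h e he

/-- Markov. -/
lemma pfil_markov {Ω : Type*} [MeasurableSpace Ω] (P : ℕ → Measure Ω) (f : ℕ → Ω → ℝ)
    (a : ℕ → ℝ) (ha : Tendsto a atTop (nhds 0))
    (h : ∀ᶠ n in atTop, (∀ ω, 0 ≤ f n ω) ∧ Integrable (f n) (P n) ∧ ∫ ω, f n ω ∂(P n) ≤ a n) :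
    Tendsto (fun p : ℕ × Ω => f p.1 p.2) (pfil P) (nhds 0) := by
  rw [pfil_tendsto_iff]
  intro e he
  have h1 : Tendsto (fun n => ENNReal.ofReal (a n / e)) atTop (nhds 0) := by
    have : Tendsto (fun n => a n / e) atTop (nhds 0) := by simpa using ha.div_const e
    simpa using ENNReal.tendsto_ofReal this
  refine tendsto_of_tendsto_of_tendsto_of_le_of_le' tendsto_const_nhds h1
    (Eventually.of_forall fun _ => zero_le) ?_
  filter_upwards [h] with n hn
  obtain ⟨h0, hi, hle⟩ := hn
  have hm := meas_ge_le_lintegral_div (μ := P n) (f := fun ω => ENNReal.ofReal (f n ω))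
    hi.1.aemeasurable.ennreal_ofReal (ε := ENNReal.ofReal e) (by simpa using he) (by simp)
  rw [← ofReal_integral_eq_lintegral_ofReal hi (Eventually.of_forall h0),
    ← ENNReal.ofReal_div_of_pos he] at hm
  refine le_trans (le_trans (measure_mono ?_) hm) ?_
  · intro ω hω
    simp only [Set.mem_ofPred_eq, sub_zero, abs_of_nonneg (h0 ω)] at hω ⊢
    exact ENNReal.ofReal_le_ofReal hω
  · apply ENNReal.ofReal_le_ofReal
    gcongr

/-- Anti-concentration at the origin. -/
def AntiConc {Ω : Type*} [MeasurableSpace Ω] (P : ℕ → Measure Ω) (Z : ℕ → Ω → ℝ) : Prop :=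
  ∀ d : ENNReal, 0 < d → ∃ η : ℝ, 0 < η ∧ ∀ᶠ n in atTop, P n {ω | |Z n ω| ≤ η} ≤ d

lemma AntiConc.add {Ω : Type*} [MeasurableSpace Ω] {P : ℕ → Measure Ω} {Z R : ℕ → Ω → ℝ}
    (hZ : AntiConc P Z) (hR : Tendsto (fun p : ℕ × Ω => R p.1 p.2) (pfil P) (nhds 0)) :
    AntiConc P (fun n ω => Z n ω + R n ω) := by
  intro d hd
  obtain ⟨η, hη, h⟩ := hZ (d / 2) (ENNReal.half_pos hd.ne')
  refine ⟨η / 2, by positivity, ?_⟩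
  have h2 := (pfil_tendsto_iff P R 0).1 hR (η / 2) (by positivity)
  have h3 : ∀ᶠ n in atTop, P n {ω | η / 2 ≤ |R n ω - 0|} ≤ d / 2 :=
    h2.eventually_le_const (ENNReal.half_pos hd.ne')
  filter_upwards [h, h3] with n hn1 hn2
  calc P n {ω | |Z n ω + R n ω| ≤ η / 2}
      ≤ P n ({ω | |Z n ω| ≤ η} ∪ {ω | η / 2 ≤ |R n ω - 0|}) := by
        apply measure_mono
        intro ω hω
        simp only [Set.mem_ofPred_eq, Set.mem_union, sub_zero] at hω ⊢
        by_contra hcon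
        push Not at hcon
        have := abs_sub_abs_le_abs_add (Z n ω) (R n ω)
        linarith
    _ ≤ d / 2 + d / 2 := (measure_union_le _ _).trans (add_le_add hn1 hn2)
    _ = d := ENNReal.add_halves d

lemma AntiConc.div {Ω : Type*} [MeasurableSpace Ω] {P : ℕ → Measure Ω} {Z R : ℕ → Ω → ℝ}
    (hZ : AntiConc P Z) (hR : Tendsto (fun p : ℕ × Ω => R p.1 p.2) (pfil P) (nhds 0)) :
    Tendsto (fun p : ℕ × Ω => R p.1 p.2 / (Z p.1 p.2) ^ 2) (pfil P) (nhds 0) := by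
  rw [pfil_tendsto_iff P (fun n ω => R n ω / (Z n ω) ^ 2)]
  intro e he
  rw [ENNReal.tendsto_nhds_zero]
  intro d hd
  obtain ⟨η, hη, h⟩ := hZ (d / 2) (ENNReal.half_pos hd.ne')
  have h2 := (pfil_tendsto_iff P R 0).1 hR (e * η ^ 2) (by positivity)
  have h3 : ∀ᶠ n in atTop, P n {ω | e * η ^ 2 ≤ |R n ω - 0|} ≤ d / 2 :=
    h2.eventually_le_const (ENNReal.half_pos hd.ne')
  filter_upwards [h, h3] with n hn1 hn2
  calc P n {ω | e ≤ |R n ω / (Z n ω) ^ 2 - 0|}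
      ≤ P n ({ω | |Z n ω| ≤ η} ∪ {ω | e * η ^ 2 ≤ |R n ω - 0|}) := by
        apply measure_mono
        intro ω hω
        simp only [Set.mem_ofPred_eq, Set.mem_union, sub_zero] at hω ⊢
        by_contra hcon
        push Not at hcon
        obtain ⟨ha, hb⟩ := hcon
        have hz : 0 < (Z n ω) ^ 2 := by
          have : 0 < |Z n ω| := hη.trans ha
          rw [← sq_abs]; positivity
        rw [abs_div, abs_of_pos hz, le_div_iff₀ hz] at hω
        have : η ^ 2 ≤ (Z n ω) ^ 2 := by
          rw [← sq_abs (Z n ω)]; gcongr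
        nlinarith
    _ ≤ d / 2 + d / 2 := (measure_union_le _ _).trans (add_le_add hn1 hn2)
    _ = d := ENNReal.add_halves d

lemma AntiConc.ne_zero {Ω : Type*} [MeasurableSpace Ω] {P : ℕ → Measure Ω} {Z : ℕ → Ω → ℝ}
    (hZ : AntiConc P Z) : ∀ᶠ p in pfil P, Z p.1 p.2 ≠ 0 := by
  rw [Filter.Eventually, mem_pfil, ENNReal.tendsto_nhds_zero]
  intro d hd
  obtain ⟨η, hη, h⟩ := hZ d hd
  filter_upwards [h] with n hn
  refine le_trans (measure_mono ?_) hn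
  intro ω hω
  simp only [ne_eq, Set.mem_ofPred_eq, not_not] at hω ⊢
  simp [hω, hη.le]

/-- The shock structure on one probability space. -/
structure Shk {Ω : Type*} [mΩ : MeasurableSpace Ω] (μ : Measure Ω) (F : ℕ → MeasurableSpace Ω)
    (σ ε : ℕ → Ω → ℝ) (N : ℕ) : Prop where
  prob : IsProbabilityMeasure μ
  mono : Monotone F
  le : ∀ t, F t ≤ mΩ
  σmeas : ∀ t, 1 ≤ t → t ≤ N → Measurable[F (t - 1)] (σ t)
  σint : ∀ t, 1 ≤ t → t ≤ N → Integrable (fun ω => (σ t ω) ^ 2) μ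
  εmeas : ∀ t, Measurable (ε t)
  gauss : ∀ t, 1 ≤ t → t ≤ N → Measure.map (ε t) μ = gaussianReal 0 1
  indep : ∀ t, 1 ≤ t → t ≤ N → Indep (MeasurableSpace.comap (ε t) inferInstance) (F (t - 1)) μ
  adapted : ∀ t, 1 ≤ t → t ≤ N → Measurable[F t] (fun ω => σ t ω * ε t ω)

section
variable {Ω : Type*} [mΩ : MeasurableSpace Ω] {μ : Measure Ω} {F : ℕ → MeasurableSpace Ω}
    {σ ε : ℕ → Ω → ℝ} {N : ℕ}

lemma Shk.indepFun (h : Shk μ F σ ε N) {E : Type*} [MeasurableSpace E] {t : ℕ} (h1 : 1 ≤ t)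
    (h2 : t ≤ N) {g : Ω → E} (hg : Measurable[F (t - 1)] g) : IndepFun g (ε t) μ := by
  rw [IndepFun_iff_Indep]
  exact (indep_of_indep_of_le_right (h.indep t h1 h2) hg.comap_le).symm

lemma gauss_inner (z : ℂ) (ρ : ℝ) :
    ∫ e, z * Complex.exp (Complex.I * ((ρ * e : ℝ) : ℂ) + ((ρ ^ 2 / 2 : ℝ) : ℂ))
      ∂(gaussianReal 0 1) = z := by
  have h := charFun_gaussianReal (μ := 0) (v := 1) ρ
  rw [charFun_apply_real] at h
  have : ∀ e : ℝ, z * Complex.exp (Complex.I * ((ρ * e : ℝ) : ℂ) + ((ρ ^ 2 / 2 : ℝ) : ℂ))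
      = (z * Complex.exp ((ρ ^ 2 / 2 : ℝ) : ℂ)) * Complex.exp (ρ * e * Complex.I) := by
    intro e
    rw [Complex.exp_add]
    push_cast
    rw [mul_comm Complex.I]
    ring
  simp_rw [this]
  rw [integral_const_mul, h, mul_assoc, ← Complex.exp_add]
  simp

lemma Shk.expmart (h : Shk μ F σ ε N) (ρ : ℕ → Ω → ℝ) (K : ℝ)
    (hρ : ∀ t, 1 ≤ t → t ≤ N → Measurable[F (t - 1)] (ρ t))
    (hρε : ∀ t, 1 ≤ t → t ≤ N → Measurable[F t] (fun ω => ρ t ω * ε t ω))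
    (hK : ∀ k, k ≤ N → ∀ ω, ∑ t ∈ Finset.Icc 1 k, (ρ t ω) ^ 2 ≤ K) (k : ℕ) (hk : k ≤ N) :
    ∫ ω, Complex.exp (Complex.I * ((∑ t ∈ Finset.Icc 1 k, ρ t ω * ε t ω : ℝ) : ℂ) +
      ((∑ t ∈ Finset.Icc 1 k, (ρ t ω) ^ 2 / 2 : ℝ) : ℂ)) ∂μ = 1 := by
  have := h.prob
  induction k with
  | zero => simp
  | succ k ih =>
    have ih := ih (by omega)
    set G : Ω → ℂ := fun ω => Complex.exp
      (Complex.I * ((∑ t ∈ Finset.Icc 1 k, ρ t ω * ε t ω : ℝ) : ℂ) +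
      ((∑ t ∈ Finset.Icc 1 k, (ρ t ω) ^ 2 / 2 : ℝ) : ℂ)) with hG
    have hGm : Measurable[F k] G := by
      have a1 : Measurable[F k] (fun ω => ∑ t ∈ Finset.Icc 1 k, ρ t ω * ε t ω) := by
        refine Finset.measurable_fun_sum _ fun t ht => ?_
        rw [Finset.mem_Icc] at ht
        exact (hρε t ht.1 (by omega)).mono (h.mono ht.2) le_rfl
      have a2 : Measurable[F k] (fun ω => ∑ t ∈ Finset.Icc 1 k, (ρ t ω) ^ 2 / 2) := by
        refine Finset.measurable_fun_sum _ fun t ht => ?_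
        rw [Finset.mem_Icc] at ht
        have : Measurable[F k] (ρ t) := (hρ t ht.1 (by omega)).mono (h.mono (by omega)) le_rfl
        exact (this.pow_const 2).div_const 2
      exact Complex.measurable_exp.comp (((Complex.measurable_ofReal.comp a1).const_mul _).add
        (Complex.measurable_ofReal.comp a2))
    have hρk : Measurable[F k] (ρ (k + 1)) := by simpa using hρ (k + 1) (by omega) hk
    have hpair : Measurable[F k] (fun ω => (G ω, ρ (k + 1) ω)) := hGm.prodMk hρk
    have hind : IndepFun (fun ω => (G ω, ρ (k + 1) ω)) (ε (k + 1)) μ :=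
      h.indepFun (by omega) hk (by simpa using hpair)
    have hpm : Measurable (fun ω => (G ω, ρ (k + 1) ω)) := hpair.mono (h.le k) le_rfl
    have hem := h.εmeas (k + 1)
    have hmap := (indepFun_iff_map_prod_eq_prod_map_map hpm.aemeasurable hem.aemeasurable).1 hind
    let f : (ℂ × ℝ) × ℝ → ℂ := fun q => q.1.1 *
      Complex.exp (Complex.I * ((q.1.2 * q.2 : ℝ) : ℂ) + ((q.1.2 ^ 2 / 2 : ℝ) : ℂ))
    have hf : Measurable f := by fun_prop
    have hcomp : ∀ ω, Complex.exp
        (Complex.I * ((∑ t ∈ Finset.Icc 1 (k + 1), ρ t ω * ε t ω : ℝ) : ℂ) +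
        ((∑ t ∈ Finset.Icc 1 (k + 1), (ρ t ω) ^ 2 / 2 : ℝ) : ℂ))
        = f ((G ω, ρ (k + 1) ω), ε (k + 1) ω) := by
      intro ω
      simp only [f, hG]
      rw [← Complex.exp_add, Finset.sum_Icc_succ_top (by omega), Finset.sum_Icc_succ_top (by omega)]
      push_cast
      ring_nf
    have hint : Integrable (fun ω => f ((G ω, ρ (k + 1) ω), ε (k + 1) ω)) μ := by
      refine Integrable.of_bound (C := Real.exp (K / 2))
        (hf.comp (hpm.prodMk hem)).aestronglyMeasurable (Eventually.of_forall fun ω => ?_)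
      rw [← hcomp, Complex.norm_exp]
      apply Real.exp_le_exp.2
      have := hK (k + 1) hk ω
      rw [Complex.add_re, Complex.ofReal_re, Complex.mul_re]
      simp only [Complex.I_re, Complex.I_im, Complex.ofReal_im, Complex.ofReal_re]
      rw [← Finset.sum_div]
      linarith
    simp_rw [hcomp]
    rw [← integral_map (μ := μ) (φ := fun ω => ((G ω, ρ (k + 1) ω), ε (k + 1) ω))
      (hpm.prodMk hem).aemeasurable hf.aestronglyMeasurable, hmap]
    have hint2 := (integrable_map_measure (μ := μ)
      (f := fun ω => ((G ω, ρ (k + 1) ω), ε (k + 1) ω)) (g := f)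
      hf.aestronglyMeasurable (hpm.prodMk hem).aemeasurable).2 hint
    rw [hmap] at hint2
    have : IsProbabilityMeasure (Measure.map (ε (k + 1)) μ) :=
      Measure.isProbabilityMeasure_map hem.aemeasurable
    have : IsProbabilityMeasure (Measure.map (fun ω => (G ω, ρ (k + 1) ω)) μ) :=
      Measure.isProbabilityMeasure_map hpm.aemeasurable
    rw [integral_prod _ hint2]
    simp only [f]
    rw [h.gauss (k + 1) (by omega) hk]
    simp_rw [gauss_inner]
    rw [integral_map hpm.aemeasurable (by fun_prop)]
    exact ih

lemma Shk.σm (h : Shk μ F σ ε N) {t : ℕ} (h1 : 1 ≤ t) (h2 : t ≤ N) : Measurable (σ t) :=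
  (h.σmeas t h1 h2).mono (h.le _) le_rfl

lemma Shk.um (h : Shk μ F σ ε N) {t : ℕ} (h1 : 1 ≤ t) (h2 : t ≤ N) :
    Measurable (fun ω => σ t ω * ε t ω) :=
  (h.adapted t h1 h2).mono (h.le _) le_rfl

lemma gauss_memLp : MemLp (id : ℝ → ℝ) 2 (gaussianReal 0 1) := by
  exact_mod_cast memLp_id_gaussianReal (μ := 0) (v := 1) 2

lemma Shk.ε_memLp (h : Shk μ F σ ε N) {t : ℕ} (h1 : 1 ≤ t) (h2 : t ≤ N) : MemLp (ε t) 2 μ := by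
  have := gauss_memLp
  rw [← h.gauss t h1 h2] at this
  exact this.comp_of_map (h.εmeas t).aemeasurable

lemma Shk.ε_int (h : Shk μ F σ ε N) {t : ℕ} (h1 : 1 ≤ t) (h2 : t ≤ N) : ∫ ω, ε t ω ∂μ = 0 := by
  have h3 := integral_map (μ := μ) (h.εmeas t).aemeasurable
    (f := fun x : ℝ => x) (by fun_prop)
  rw [← h3, h.gauss t h1 h2, integral_id_gaussianReal]

lemma Shk.ε_sq (h : Shk μ F σ ε N) {t : ℕ} (h1 : 1 ≤ t) (h2 : t ≤ N) :
    ∫ ω, (ε t ω) ^ 2 ∂μ = 1 := by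
  have h3 := integral_map (μ := μ) (h.εmeas t).aemeasurable
    (f := fun x : ℝ => x ^ 2) (by fun_prop)
  rw [← h3, h.gauss t h1 h2]
  have h4 := variance_eq_sub (μ := gaussianReal 0 1) (X := fun x => x) gauss_memLp
  rw [variance_fun_id_gaussianReal] at h4
  simpa using h4.symm

lemma Shk.u_sq (h : Shk μ F σ ε N) {t : ℕ} (h1 : 1 ≤ t) (h2 : t ≤ N) :
    Integrable (fun ω => (σ t ω * ε t ω) ^ 2) μ ∧
      ∫ ω, (σ t ω * ε t ω) ^ 2 ∂μ = ∫ ω, (σ t ω) ^ 2 ∂μ := by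
  have hi : IndepFun (fun ω => (σ t ω) ^ 2) (fun ω => (ε t ω) ^ 2) μ :=
    (h.indepFun h1 h2 (h.σmeas t h1 h2)).comp (φ := fun x => x ^ 2) (ψ := fun x => x ^ 2)
      (by fun_prop) (by fun_prop)
  simp_rw [mul_pow]
  refine ⟨hi.integrable_mul (h.σint t h1 h2) (h.ε_memLp h1 h2).integrable_sq, ?_⟩
  rw [hi.integral_fun_mul_eq_mul_integral ((h.σm h1 h2).pow_const 2).aestronglyMeasurable
    ((h.εmeas t).pow_const 2).aestronglyMeasurable, h.ε_sq h1 h2, mul_one]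

lemma Shk.u_memLp (h : Shk μ F σ ε N) {t : ℕ} (h1 : 1 ≤ t) (h2 : t ≤ N) :
    MemLp (fun ω => σ t ω * ε t ω) 2 μ :=
  (memLp_two_iff_integrable_sq (h.um h1 h2).aestronglyMeasurable).2 (h.u_sq h1 h2).1

lemma Shk.u_orth (h : Shk μ F σ ε N) {s t : ℕ} (h1 : 1 ≤ s) (hst : s < t) (h2 : t ≤ N) :
    ∫ ω, (σ s ω * ε s ω) * (σ t ω * ε t ω) ∂μ = 0 := by
  have hm : Measurable[F (t - 1)] (fun ω => (σ s ω * ε s ω) * σ t ω) :=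
    ((h.adapted s h1 (by omega)).mono (h.mono (by omega)) le_rfl).mul
      (h.σmeas t (by omega) h2)
  have hi := h.indepFun (by omega) h2 hm
  have e : ∀ ω, (σ s ω * ε s ω) * (σ t ω * ε t ω) = ((σ s ω * ε s ω) * σ t ω) * ε t ω := by
    intro ω; ring
  simp_rw [e]
  rw [hi.integral_fun_mul_eq_mul_integral (hm.mono (h.le _) le_rfl).aestronglyMeasurable
    (h.εmeas t).aestronglyMeasurable, h.ε_int (by omega) h2, mul_zero]

lemma Shk.sum_sq (h : Shk μ F σ ε N) (w : ℕ → ℝ) (s : Finset ℕ) (hs : s ⊆ Finset.Icc 1 N) :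
    Integrable (fun ω => (∑ t ∈ s, w t * (σ t ω * ε t ω)) ^ 2) μ ∧
      ∫ ω, (∑ t ∈ s, w t * (σ t ω * ε t ω)) ^ 2 ∂μ =
        ∑ t ∈ s, (w t) ^ 2 * ∫ ω, (σ t ω) ^ 2 ∂μ := by
  have hm : ∀ t ∈ s, 1 ≤ t ∧ t ≤ N := fun t ht => Finset.mem_Icc.1 (hs ht)
  have hL : ∀ t ∈ s, MemLp (fun ω => w t * (σ t ω * ε t ω)) 2 μ := fun t ht =>
    (h.u_memLp (hm t ht).1 (hm t ht).2).const_mul _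
  refine ⟨(memLp_finsetSum s hL).integrable_sq, ?_⟩
  simp_rw [sq, Finset.sum_mul_sum]
  have hint : ∀ i ∈ s, ∀ j ∈ s, Integrable
      (fun ω => w i * (σ i ω * ε i ω) * (w j * (σ j ω * ε j ω))) μ := fun i hi j hj =>
    (hL i hi).integrable_mul (hL j hj)
  rw [integral_finsetSum _ (fun i hi => integrable_finsetSum _ (fun j hj => hint i hi j hj))]
  refine Finset.sum_congr rfl fun i hi => ?_
  rw [integral_finsetSum _ (fun j hj => hint i hi j hj), Finset.sum_eq_single i]
  · rw [← integral_const_mul]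
    have := (h.u_sq (hm i hi).1 (hm i hi).2).2
    have e : ∀ ω, w i * (σ i ω * ε i ω) * (w i * (σ i ω * ε i ω))
      = w i * w i * (σ i ω * ε i ω) ^ 2 := by intro ω; ring
    simp_rw [e]
    rw [integral_const_mul, integral_const_mul, this]
    simp_rw [sq]
  · intro j hj hji
    have e : ∀ ω, w i * (σ i ω * ε i ω) * (w j * (σ j ω * ε j ω))
      = w i * w j * ((σ i ω * ε i ω) * (σ j ω * ε j ω)) := by intro ω; ring
    simp_rw [e]
    rw [integral_const_mul]
    rcases lt_or_gt_of_ne hji with hl | hl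
    · simp_rw [mul_comm (σ i _ * ε i _)]
      rw [h.u_orth (hm j hj).1 hl (hm i hi).2, mul_zero]
    · rw [h.u_orth (hm i hi).1 hl (hm j hj).2, mul_zero]
  · intro hn; exact absurd hi hn

end

lemma pfil_bdd {Ω : Type*} [MeasurableSpace Ω] (P : ℕ → Measure Ω)
    (hP : ∀ n, IsProbabilityMeasure (P n)) (f : ℕ → Ω → ℝ) (C : ℝ)
    (hm : ∀ n, Measurable (f n)) (h0 : ∀ n ω, 0 ≤ f n ω) (hC : ∀ n ω, f n ω ≤ C)
    (hf : Tendsto (fun p : ℕ × Ω => f p.1 p.2) (pfil P) (nhds 0)) :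
    Tendsto (fun n => ∫ ω, f n ω ∂(P n)) atTop (nhds 0) := by
  have hint : ∀ n, Integrable (f n) (P n) := fun n =>
    Integrable.of_bound (C := C) (hm n).aestronglyMeasurable
      (Eventually.of_forall fun ω => by rw [Real.norm_eq_abs, abs_of_nonneg (h0 n ω)]; exact hC n ω)
  rw [Metric.tendsto_nhds]
  intro e he
  have h1 := (pfil_tendsto_iff P f 0).1 hf (e / 2) (by positivity)
  have h2 := (ENNReal.tendsto_toReal ENNReal.zero_ne_top).comp h1
  have h3 : Tendsto (fun n => C * (P n).real {ω | e / 2 ≤ |f n ω - 0|}) atTop (nhds 0) := by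
    simpa [Measure.real] using h2.const_mul C
  filter_upwards [h3.eventually_lt_const (show (0 : ℝ) < e / 2 by positivity)] with n hn
  rw [Real.dist_eq, sub_zero, abs_of_nonneg (integral_nonneg (h0 n))]
  have hms : MeasurableSet {ω | e / 2 ≤ |f n ω - 0|} :=
    measurableSet_le measurable_const ((hm n).sub_const 0).abs
  have hle : ∫ ω, f n ω ∂(P n) ≤
      ∫ ω, (e / 2 + C * Set.indicator {ω | e / 2 ≤ |f n ω - 0|} 1 ω) ∂(P n) := by
    refine integral_mono (hint n) ?_ ?_
    · exact (integrable_const _).add (((integrable_const (1 : ℝ)).indicator hms).const_mul C)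
    · intro ω
      have hc : 0 ≤ C := (h0 n ω).trans (hC n ω)
      by_cases hω : e / 2 ≤ |f n ω - 0|
      · simp only [Set.indicator, Set.mem_ofPred_eq, hω, if_true, Pi.one_apply, mul_one]
        linarith [hC n ω]
      · simp only [Set.indicator, Set.mem_ofPred_eq, hω, if_false, mul_zero, add_zero]
        push Not at hω
        rw [sub_zero, abs_of_nonneg (h0 n ω)] at hω
        exact hω.le
  have hi1 : Integrable (fun ω => C * Set.indicator {ω | e / 2 ≤ |f n ω - 0|} 1 ω) (P n) :=
    ((integrable_const (1 : ℝ)).indicator hms).const_mul C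
  rw [integral_add (integrable_const _) hi1, integral_const_mul,
    integral_indicator_one hms] at hle
  simp only [integral_const, probReal_univ, one_smul] at hle
  linarith

lemma gauss_small (v : NNReal) (hv : v ≠ 0) (d : ENNReal) (hd : 0 < d) :
    ∃ η : ℝ, 0 < η ∧ gaussianReal 0 v (Metric.closedBall 0 η) < d := by
  have h := tendsto_measure_cthickening_of_isClosed (μ := gaussianReal 0 v) (s := {(0 : ℝ)})
    ⟨1, one_pos, measure_ne_top _ _⟩ isClosed_singleton
  have : NullSingletonClass (gaussianReal 0 v) := nullSingletonClass_gaussianReal hv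
  rw [measure_singleton] at h
  have h2 : ∀ᶠ x in nhdsWithin (0 : ℝ) (Set.Ioi 0),
      gaussianReal 0 v (Metric.cthickening x {0}) < d :=
    (h.mono_left nhdsWithin_le_nhds).eventually_lt_const hd
  obtain ⟨η, h3, h4⟩ := (h2.and self_mem_nhdsWithin).exists
  have h4 : 0 < η := h4
  refine ⟨η, h4, ?_⟩
  rwa [Metric.cthickening_singleton _ h4.le] at h3

lemma clt_cf {Ω : Type*} [MeasurableSpace Ω] (P : ℕ → Measure Ω)
    (F : ℕ → ℕ → MeasurableSpace Ω) (σ ε : ℕ → ℕ → Ω → ℝ)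
    (h : ∀ n, Shk (P n) (F n) (σ n) (ε n) n) (k : ℕ → ℕ) (hk : ∀ n, k n ≤ n) (s : ℕ → ℝ)
    (v : ℝ) (hv : 0 < v)
    (hV : Tendsto (fun p : ℕ × Ω => ∑ t ∈ Finset.Icc 1 (k p.1), (σ p.1 t p.2 / s p.1) ^ 2)
      (pfil P) (nhds v)) (θ : ℝ) :
    Tendsto (fun n => ∫ ω, Complex.exp (Complex.I *
      ((θ * ((∑ t ∈ Finset.Icc 1 (k n), σ n t ω * ε n t ω) / s n) : ℝ) : ℂ)) ∂(P n)) atTop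
      (nhds (Complex.exp ((-(θ ^ 2 * v / 2) : ℝ) : ℂ))) := by
  have hP : ∀ n, IsProbabilityMeasure (P n) := fun n => (h n).prob
  let V : ℕ → ℕ → Ω → ℝ := fun n t ω => ∑ j ∈ Finset.Icc 1 t, (σ n j ω / s n) ^ 2
  let ρ : ℕ → ℕ → Ω → ℝ := fun n t ω => if V n t ω ≤ v + 1 then θ * (σ n t ω / s n) else 0
  have hVm : ∀ n t, t ≤ n → Measurable[F n (t - 1)] (V n t) := by
    intro n t ht
    refine Finset.measurable_fun_sum _ fun j hj => ?_
    rw [Finset.mem_Icc] at hj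
    have : Measurable[F n (t - 1)] (σ n j) :=
      ((h n).σmeas j hj.1 (by omega)).mono ((h n).mono (by omega)) le_rfl
    exact (this.div_const _).pow_const 2
  have hρ : ∀ n t, 1 ≤ t → t ≤ n → Measurable[F n (t - 1)] (ρ n t) := by
    intro n t h1 h2
    refine Measurable.ite (hVm n t h2 measurableSet_Iic) ?_ measurable_const
    exact (((h n).σmeas t h1 h2).div_const _).const_mul _
  have hρε : ∀ n t, 1 ≤ t → t ≤ n → Measurable[F n t] (fun ω => ρ n t ω * ε n t ω) := by
    intro n t h1 h2
    have e : (fun ω => ρ n t ω * ε n t ω) = fun ω => if V n t ω ≤ v + 1 then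
        θ / s n * (σ n t ω * ε n t ω) else 0 := by
      funext ω
      simp only [ρ]
      split_ifs
      · ring
      · ring
    rw [e]
    have hv' : Measurable[F n t] (V n t) := (hVm n t h2).mono ((h n).mono (by omega)) le_rfl
    refine Measurable.ite (hv' measurableSet_Iic) ?_ measurable_const
    exact ((h n).adapted t h1 h2).const_mul _
  have hK : ∀ n k, ∀ ω, ∑ t ∈ Finset.Icc 1 k, (ρ n t ω) ^ 2 ≤ θ ^ 2 * (v + 1) := by
    intro n k ω
    induction k with
    | zero => simp; positivity
    | succ k ih =>
      by_cases hc : V n (k + 1) ω ≤ v + 1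
      · calc ∑ t ∈ Finset.Icc 1 (k + 1), (ρ n t ω) ^ 2
            ≤ ∑ t ∈ Finset.Icc 1 (k + 1), θ ^ 2 * (σ n t ω / s n) ^ 2 := by
              refine Finset.sum_le_sum fun t _ => ?_
              simp only [ρ]
              split_ifs
              · rw [mul_pow]
              · have : 0 ≤ θ ^ 2 * (σ n t ω / s n) ^ 2 := by positivity
                simpa using this
          _ = θ ^ 2 * V n (k + 1) ω := by rw [← Finset.mul_sum]
          _ ≤ _ := by gcongr
      · rw [Finset.sum_Icc_succ_top (by omega)]
        have h0 : ρ n (k + 1) ω = 0 := by simp only [ρ, hc, if_false]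
        rw [h0]
        simpa using ih
  let U : ℕ → Ω → ℝ := fun n ω => ∑ t ∈ Finset.Icc 1 (k n), ρ n t ω * ε n t ω
  let W : ℕ → Ω → ℝ := fun n ω => ∑ t ∈ Finset.Icc 1 (k n), (ρ n t ω) ^ 2 / 2
  let S : ℕ → Ω → ℝ := fun n ω => θ * ((∑ t ∈ Finset.Icc 1 (k n), σ n t ω * ε n t ω) / s n)
  have hUm : ∀ n, Measurable (U n) := by
    intro n
    refine Finset.measurable_fun_sum _ fun t ht => ?_
    rw [Finset.mem_Icc] at ht
    exact (hρε n t ht.1 (ht.2.trans (hk n))).mono ((h n).le _) le_rfl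
  have hWm : ∀ n, Measurable (W n) := by
    intro n
    refine Finset.measurable_fun_sum _ fun t ht => ?_
    rw [Finset.mem_Icc] at ht
    exact (((hρ n t ht.1 (ht.2.trans (hk n))).mono ((h n).le _) le_rfl).pow_const 2).div_const 2
  have hSm : ∀ n, Measurable (S n) := by
    intro n
    refine Measurable.const_mul (Measurable.div_const ?_ _) _
    refine Finset.measurable_fun_sum _ fun t ht => ?_
    rw [Finset.mem_Icc] at ht
    exact (h n).um ht.1 (ht.2.trans (hk n))
  have hWle : ∀ n ω, W n ω ≤ θ ^ 2 * (v + 1) / 2 := by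
    intro n ω
    have := hK n (k n) ω
    simp only [W, ← Finset.sum_div]
    linarith
  let c : ℝ := θ ^ 2 * v / 2
  let A : ℕ → Ω → ℂ := fun n ω => Complex.exp (Complex.I * (U n ω : ℂ) + ((W n ω : ℝ) : ℂ)) *
    Complex.exp ((-c : ℝ) : ℂ)
  let B : ℕ → Ω → ℂ := fun n ω => Complex.exp (Complex.I * (S n ω : ℂ))
  have hAn : ∀ n ω, ‖A n ω‖ ≤ Real.exp (θ ^ 2 * (v + 1) / 2) * Real.exp (-c) := by
    intro n ω
    simp only [A]
    rw [norm_mul, Complex.norm_exp, Complex.norm_exp]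
    simp only [Complex.add_re, Complex.mul_re, Complex.I_re, Complex.I_im, Complex.ofReal_re,
      Complex.ofReal_im, zero_mul, mul_zero, sub_zero, zero_add]
    gcongr
    exact hWle n ω
  have hBn : ∀ n ω, ‖B n ω‖ ≤ 1 := by
    intro n ω
    simp only [B]
    rw [Complex.norm_exp]
    simp
  have hAm : ∀ n, Measurable (A n) := by
    intro n
    have := hUm n
    have := hWm n
    fun_prop
  have hBm : ∀ n, Measurable (B n) := by
    intro n
    have := hSm n
    fun_prop
  have hAi : ∀ n, Integrable (A n) (P n) := fun n =>
    Integrable.of_bound (hAm n).aestronglyMeasurable _ (Eventually.of_forall (hAn n))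
  have hBi : ∀ n, Integrable (B n) (P n) := fun n =>
    Integrable.of_bound (hBm n).aestronglyMeasurable _ (Eventually.of_forall (hBn n))
  have hAint : ∀ n, ∫ ω, A n ω ∂(P n) = Complex.exp ((-c : ℝ) : ℂ) := by
    intro n
    simp only [A]
    rw [integral_mul_const]
    have := (h n).expmart (ρ n) _ (hρ n) (hρε n) (fun k _ ω => hK n k ω) (k n) (hk n)
    simp only [U, W]
    rw [this, one_mul]
  have key : Tendsto (fun n => ∫ ω, ‖A n ω - B n ω‖ ∂(P n)) atTop (nhds 0) := by
    refine pfil_bdd P hP (fun n ω => ‖A n ω - B n ω‖)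
      (Real.exp (θ ^ 2 * (v + 1) / 2) * Real.exp (-c) + 1)
      (fun n => ((hAm n).sub (hBm n)).norm) (fun n ω => norm_nonneg _)
      (fun n ω => (norm_sub_le _ _).trans (add_le_add (hAn n ω) (hBn n ω))) ?_
    have hlim : Tendsto (fun p : ℕ × Ω => |Real.exp (θ ^ 2 * V p.1 (k p.1) p.2 / 2 - c) - 1|)
        (pfil P) (nhds 0) := by
      have hcont : Continuous (fun x : ℝ => |Real.exp (θ ^ 2 * x / 2 - c) - 1|) := by fun_prop
      have := (hcont.tendsto v).comp hV
      simpa [c, Function.comp_def, V] using this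
    refine hlim.congr' ?_
    filter_upwards [hV.eventually_le_const (show v < v + 1 by linarith)] with p hp
    obtain ⟨n, ω⟩ := p
    simp only at hp ⊢
    have hVle : ∀ t ∈ Finset.Icc 1 (k n), V n t ω ≤ v + 1 := by
      intro t ht
      rw [Finset.mem_Icc] at ht
      refine le_trans ?_ hp
      exact Finset.sum_le_sum_of_subset_of_nonneg (Finset.Icc_subset_Icc_right ht.2)
        (fun _ _ _ => sq_nonneg _)
    have hUS : U n ω = S n ω := by
      simp only [U, S]
      rw [Finset.sum_div, Finset.mul_sum]
      refine Finset.sum_congr rfl fun t ht => ?_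
      simp only [ρ, hVle t ht, if_true]
      ring
    have hWV : W n ω = θ ^ 2 * V n (k n) ω / 2 := by
      simp only [W]
      rw [Finset.mul_sum, Finset.sum_div]
      refine Finset.sum_congr rfl fun t ht => ?_
      simp only [ρ, hVle t ht, if_true]
      ring
    have : A n ω - B n ω = B n ω * ((Real.exp (W n ω - c) - 1 : ℝ) : ℂ) := by
      simp only [A, B]
      rw [hUS, Complex.exp_add]
      push_cast
      rw [sub_eq_add_neg (W n ω : ℂ), Complex.exp_add]
      ring
    rw [this, norm_mul, Complex.norm_real, Real.norm_eq_abs, hWV]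
    have hB1 : ‖B n ω‖ = 1 := by
      simp only [B]
      rw [Complex.norm_exp]
      simp
    rw [hB1, one_mul]
  rw [tendsto_iff_norm_sub_tendsto_zero]
  refine squeeze_zero (fun _ => norm_nonneg _) (fun n => ?_) key
  change ‖∫ ω, B n ω ∂(P n) - Complex.exp ((-c : ℝ) : ℂ)‖ ≤ _
  rw [← hAint n, ← integral_sub (hBi n) (hAi n)]
  refine (norm_integral_le_integral_norm _).trans (le_of_eq ?_)
  simp_rw [norm_sub_rev]

lemma clt_anti {Ω : Type*} [MeasurableSpace Ω] (P : ℕ → Measure Ω)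
    (F : ℕ → ℕ → MeasurableSpace Ω) (σ ε : ℕ → ℕ → Ω → ℝ)
    (h : ∀ n, Shk (P n) (F n) (σ n) (ε n) n) (k : ℕ → ℕ) (hk : ∀ n, k n ≤ n) (s : ℕ → ℝ)
    (v : ℝ) (hv : 0 < v)
    (hV : Tendsto (fun p : ℕ × Ω => ∑ t ∈ Finset.Icc 1 (k p.1), (σ p.1 t p.2 / s p.1) ^ 2)
      (pfil P) (nhds v)) :
    AntiConc P (fun n ω => (∑ t ∈ Finset.Icc 1 (k n), σ n t ω * ε n t ω) / s n) := by
  have hP : ∀ n, IsProbabilityMeasure (P n) := fun n => (h n).prob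
  let S : ℕ → Ω → ℝ := fun n ω => (∑ t ∈ Finset.Icc 1 (k n), σ n t ω * ε n t ω) / s n
  have hSm : ∀ n, Measurable (S n) := by
    intro n
    refine Measurable.div_const ?_ _
    refine Finset.measurable_fun_sum _ fun t ht => ?_
    rw [Finset.mem_Icc] at ht
    exact (h n).um ht.1 (ht.2.trans (hk n))
  let ν : ℕ → ProbabilityMeasure ℝ := fun n =>
    ⟨Measure.map (S n) (P n), Measure.isProbabilityMeasure_map (hSm n).aemeasurable⟩
  let v' : NNReal := ⟨v, hv.le⟩
  let ν0 : ProbabilityMeasure ℝ := ⟨gaussianReal 0 v', inferInstance⟩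
  have hw : Tendsto ν atTop (nhds ν0) := by
    rw [ProbabilityMeasure.tendsto_iff_tendsto_charFun]
    intro θ
    have h1 := clt_cf P F σ ε h k hk s v hv hV θ
    have e1 : charFun (ν0 : Measure ℝ) θ = Complex.exp ((-(θ ^ 2 * v / 2) : ℝ) : ℂ) := by
      change charFun (gaussianReal 0 v') θ = _
      rw [charFun_gaussianReal]
      congr 1
      have : ((v' : ℝ) : ℂ) = (v : ℂ) := rfl
      rw [this]
      push_cast
      ring
    rw [e1]
    refine h1.congr fun n => ?_
    change _ = charFun (Measure.map (S n) (P n)) θ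
    rw [charFun_apply_real, integral_map (hSm n).aemeasurable (by fun_prop)]
    refine integral_congr_ae (Eventually.of_forall fun ω => ?_)
    simp only [S]
    congr 1
    push_cast
    ring
  intro d hd
  obtain ⟨η, hη, hg⟩ := gauss_small v' (by
    intro h0
    exact hv.ne' (congrArg NNReal.toReal h0)) d hd
  refine ⟨η, hη, ?_⟩
  have hl := ProbabilityMeasure.limsup_measure_closed_le_of_tendsto hw
    (F := Metric.closedBall (0 : ℝ) η) Metric.isClosed_closedBall
  have hl2 := eventually_lt_of_limsup_lt (hl.trans_lt hg)
  filter_upwards [hl2] with n hn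
  have e : (ν n : Measure ℝ) (Metric.closedBall 0 η) = P n {ω | |S n ω| ≤ η} := by
    change Measure.map (S n) (P n) _ = _
    rw [Measure.map_apply (hSm n) measurableSet_closedBall]
    congr 1
    ext ω
    simp [Real.norm_eq_abs]
  rw [← e]
  exact hn.le

/-- The autoregressive coefficient of the bubble model. -/
noncomputable def coefB (κ : ℝ) (e f t : ℕ) : ℝ := if e ≤ t ∧ t ≤ f then 1 + κ else 1

/-- The cumulative growth factor. -/
noncomputable def gf (κ : ℝ) (e f j : ℕ) : ℝ := ∏ t ∈ Finset.Icc 1 j, coefB κ e f t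

section
variable {κ : ℝ} {e f : ℕ}

lemma gf_zero : gf κ e f 0 = 1 := by simp [gf]

lemma gf_succ (j : ℕ) : gf κ e f (j + 1) = coefB κ e f (j + 1) * gf κ e f j := by
  rw [gf, Finset.prod_Icc_succ_top (by omega), mul_comm]; rfl

lemma coefB_one_le (hκ : 0 ≤ κ) (t : ℕ) : 1 ≤ coefB κ e f t := by
  unfold coefB; split_ifs <;> linarith

lemma gf_one_le (hκ : 0 ≤ κ) (j : ℕ) : 1 ≤ gf κ e f j := by
  induction j with
  | zero => simp [gf]
  | succ j ih =>
    rw [gf_succ]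
    nlinarith [coefB_one_le (e := e) (f := f) hκ (j + 1)]

lemma gf_pos (hκ : 0 ≤ κ) (j : ℕ) : 0 < gf κ e f j := by linarith [gf_one_le (e := e) (f := f) hκ j]

lemma gf_mono (hκ : 0 ≤ κ) : Monotone (gf κ e f) := by
  refine monotone_nat_of_le_succ fun j => ?_
  rw [gf_succ]
  nlinarith [coefB_one_le (e := e) (f := f) hκ (j + 1), gf_one_le (e := e) (f := f) hκ j]

lemma gf_before (j : ℕ) (hj : j < e) : gf κ e f j = 1 := by
  induction j with
  | zero => simp [gf]
  | succ j ih =>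
    rw [gf_succ, ih (by omega), coefB, if_neg (by omega), one_mul]

lemma gf_after (j : ℕ) (hj : f ≤ j) : gf κ e f j = gf κ e f f := by
  induction j, hj using Nat.le_induction with
  | base => rfl
  | succ j hj ih => rw [gf_succ, ih, coefB, if_neg (by omega), one_mul]

lemma gf_lower (hκ : 0 ≤ κ) (j : ℕ) (hj : j ≤ f) : 1 + κ * ((j : ℝ) - e) ≤ gf κ e f j := by
  induction j with
  | zero =>
    rw [gf_zero]
    have : (0 : ℝ) ≤ e := Nat.cast_nonneg e
    push_cast
    nlinarith
  | succ j ih =>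
    have ih := ih (by omega)
    by_cases hc : e ≤ j + 1
    · rw [gf_succ, coefB, if_pos ⟨hc, hj⟩]
      have := gf_one_le (e := e) (f := f) hκ j
      push_cast
      nlinarith
    · rw [gf_before _ (by omega)]
      have : ((j + 1 : ℕ) : ℝ) ≤ e := by exact_mod_cast (by omega)
      nlinarith

lemma gf_sum (hκ : 0 ≤ κ) (m : ℕ) (hm : m ≤ f) :
    κ * ∑ j ∈ Finset.range m, gf κ e f j ≤ κ * m + gf κ e f m := by
  induction m with
  | zero => simp [gf]
  | succ m ih =>
    have ih := ih (by omega)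
    rw [Finset.sum_range_succ, mul_add]
    by_cases hc : e ≤ m + 1
    · rw [gf_succ, coefB, if_pos ⟨hc, hm⟩]
      push_cast
      nlinarith
    · have h1 : gf κ e f m = 1 := gf_before _ (by omega)
      have h2 : gf κ e f (m + 1) = 1 := gf_before _ (by omega)
      rw [h1] at ih ⊢
      rw [h2]
      push_cast
      linarith

lemma gf_solve (hκ : 0 ≤ κ) (n : ℕ) (x u : ℕ → ℝ)
    (hx : ∀ t, 1 ≤ t → t ≤ n → x t = coefB κ e f t * x (t - 1) + u t) (j : ℕ) (hj : j ≤ n) :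
    x j = gf κ e f j * (x 0 + ∑ t ∈ Finset.Icc 1 j, u t / gf κ e f t) := by
  induction j with
  | zero => simp [gf]
  | succ j ih =>
    rw [hx (j + 1) (by omega) hj, Nat.add_sub_cancel, ih (by omega),
      Finset.sum_Icc_succ_top (by omega), gf_succ]
    have h1 : 0 < coefB κ e f (j + 1) := by linarith [coefB_one_le (e := e) (f := f) hκ (j + 1)]
    have h2 := gf_pos (e := e) (f := f) hκ j
    field_simp
    ring

end

lemma sum_shift (g : ℕ → ℕ → ℝ) (N : ℕ) :
    ∑ j ∈ Finset.Icc 1 N, g (j - 1) j = ∑ j ∈ Finset.range N, g j (j + 1) := by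
  induction N with
  | zero => simp
  | succ N ih => rw [Finset.sum_Icc_succ_top (by omega), ih, Finset.sum_range_succ]; simp

lemma svadf_formula {Ω : Type*} (X : ℕ → Ω → ℝ) (N : ℕ) (hN : 1 ≤ N) (ω : Ω) (hX : X N ω ≠ 0)
    (y : ℕ → ℝ) (hy : ∀ j, y j = X j ω / X N ω) (S1 S2 D : ℝ)
    (hS1 : S1 = (∑ j ∈ Finset.range N, y j) / N)
    (hS2 : S2 = (∑ j ∈ Finset.range N, (y j) ^ 2) / N)
    (hD : D = ∑ j ∈ Finset.range N, (y (j + 1) - y j) ^ 2)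
    (hne : S2 - S1 ^ 2 ≠ 0) :
    svadfDelta X N ω = ((1 - (y 0) ^ 2 - D) / 2 - S1 * (1 - y 0)) / (S2 - S1 ^ 2) := by
  have hN0 : (N : ℝ) ≠ 0 := by exact_mod_cast (by omega : N ≠ 0)
  have hXy : ∀ j, X j ω = X N ω * y j := fun j => by rw [hy]; field_simp
  have hyN : y N = 1 := by rw [hy]; field_simp
  have hb : xbar X N ω = X N ω * S1 := by
    rw [xbar, sum_shift (fun a _ => X a ω) N, hS1]
    rw [Finset.sum_congr rfl (fun j _ => hXy j), ← Finset.mul_sum]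
    ring
  have s1 : ∑ j ∈ Finset.range N, y j = N * S1 := by rw [hS1]; field_simp
  have s2 : ∑ j ∈ Finset.range N, (y j) ^ 2 = N * S2 := by rw [hS2]; field_simp
  have hden : ∑ j ∈ Finset.Icc 1 N, (xtil X N (j - 1) ω) ^ 2 = (X N ω) ^ 2 * (N * (S2 - S1 ^ 2)) := by
    rw [sum_shift (fun a _ => (xtil X N a ω) ^ 2) N]
    have : ∀ j, (xtil X N j ω) ^ 2 = (X N ω) ^ 2 * ((y j) ^ 2 - 2 * S1 * y j + S1 ^ 2) := by
      intro j
      rw [xtil, hb, hXy j]; ring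
    simp_rw [this]
    rw [← Finset.mul_sum, Finset.sum_add_distrib, Finset.sum_sub_distrib, ← Finset.mul_sum, s1, s2,
      Finset.sum_const, Finset.card_range, nsmul_eq_mul]
    ring
  have hnum : ∑ j ∈ Finset.Icc 1 N, xtil X N (j - 1) ω * X j ω = (X N ω) ^ 2 *
      (N * (S2 - S1 ^ 2) + ((1 - (y 0) ^ 2 - D) / 2 - S1 * (1 - y 0))) := by
    rw [sum_shift (fun a b => xtil X N a ω * X b ω) N]
    have : ∀ j, xtil X N j ω * X (j + 1) ω = (X N ω) ^ 2 * ((y j) ^ 2 - S1 * y j +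
        ((y (j + 1)) ^ 2 - (y j) ^ 2) / 2 - (y (j + 1) - y j) ^ 2 / 2
          - S1 * (y (j + 1) - y j)) := by
      intro j
      rw [xtil, hb, hXy j, hXy (j + 1)]; ring
    simp_rw [this]
    rw [← Finset.mul_sum, Finset.sum_sub_distrib, Finset.sum_sub_distrib, Finset.sum_add_distrib,
      Finset.sum_sub_distrib, ← Finset.mul_sum, ← Finset.mul_sum, ← Finset.sum_div,
      ← Finset.sum_div, Finset.sum_range_sub, Finset.sum_range_sub (fun j => (y j) ^ 2),
      s1, s2, hyN, ← hD]
    ring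
  rw [svadfDelta, deltaHat, hden, hnum]
  field_simp
  ring

lemma S_bounds (N f : ℕ) (hN : 1 ≤ N) (hf : f ≤ N) (y : ℕ → ℝ) (S1 S2 W β : ℝ)
    (hS1 : S1 = (∑ j ∈ Finset.range N, y j) / N)
    (hS2 : S2 = (∑ j ∈ Finset.range N, (y j) ^ 2) / N)
    (hW : W = (∑ j ∈ Finset.range N, (y j - if f ≤ j then 1 else 0) ^ 2) / N)
    (hβ : β = ((N : ℝ) - f) / N) :
    |S1 - β| ≤ √W ∧ |S2 - β| ≤ 2 * √W + W := by
  have hN0 : (0 : ℝ) < N := by exact_mod_cast hN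
  let b : ℕ → ℝ := fun j => if f ≤ j then 1 else 0
  have hb : ∑ j ∈ Finset.range N, b j = (N : ℝ) - f := by
    have := Finset.sum_range_add_sum_Ico b hf
    rw [← this, Finset.sum_eq_zero, Finset.sum_congr rfl (g := fun _ => (1 : ℝ))]
    · simp [Nat.cast_sub hf]
    · intro j hj
      rw [Finset.mem_Ico] at hj
      simp [b, hj.1]
    · intro j hj
      rw [Finset.mem_range] at hj
      simp [b, hj]
  have hbb : ∀ j, b j * b j = b j := by intro j; simp only [b]; split_ifs <;> simp
  have hb1 : ∀ j, (b j) ^ 2 ≤ 1 := by intro j; simp only [b]; split_ifs <;> simp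
  have cs : ∀ z : ℕ → ℝ, (∀ j, (z j) ^ 2 ≤ (y j - b j) ^ 2) →
      |(∑ j ∈ Finset.range N, z j) / N| ≤ √W := by
    intro z hz
    apply Real.abs_le_sqrt
    rw [hW, div_pow, div_le_div_iff₀ (by positivity) hN0]
    have h1 := sq_sum_le_card_mul_sum_sq (s := Finset.range N) (f := z)
    rw [Finset.card_range] at h1
    have h2 : ∑ j ∈ Finset.range N, (z j) ^ 2 ≤ ∑ j ∈ Finset.range N, (y j - b j) ^ 2 :=
      Finset.sum_le_sum fun j _ => hz j
    calc _ ≤ ((N : ℝ) * ∑ j ∈ Finset.range N, (y j - b j) ^ 2) * N := by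
          gcongr; exact h1.trans (by gcongr)
      _ = _ := by ring
  constructor
  · have := cs (fun j => y j - b j) (fun j => le_rfl)
    rw [Finset.sum_sub_distrib, hb, sub_div, ← hS1, ← hβ] at this
    exact this
  · have h1 := cs (fun j => b j * (y j - b j)) (fun j => by
      rw [mul_pow]; nlinarith [hb1 j, sq_nonneg (y j - b j)])
    have e : S2 - β = 2 * ((∑ j ∈ Finset.range N, b j * (y j - b j)) / N) + W := by
      rw [hS2, hβ, hW, ← hb]
      have : ∑ j ∈ Finset.range N, (y j - if f ≤ j then 1 else 0) ^ 2
        = ∑ j ∈ Finset.range N, (y j - b j) ^ 2 := rfl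
      rw [this, ← sub_div, ← mul_div_assoc, ← add_div, ← Finset.sum_sub_distrib, Finset.mul_sum,
        ← Finset.sum_add_distrib]
      congr 1
      refine Finset.sum_congr rfl fun j _ => ?_
      linear_combination hbb j
    have hW0 : 0 ≤ W := by rw [hW]; positivity
    rw [e]
    refine (abs_add_le _ _).trans ?_
    rw [abs_mul, abs_of_nonneg hW0, abs_of_pos (by norm_num : (0 : ℝ) < 2)]
    linarith

/-- Pathwise bounds. -/
lemma path_bounds (κ : ℝ) (hκ : 0 ≤ κ) (e f N n : ℕ) (hfN : f ≤ N) (hNn : N ≤ n)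
    (x u : ℕ → ℝ) (hx : ∀ t, 1 ≤ t → t ≤ n → x t = coefB κ e f t * x (t - 1) + u t)
    (s : ℝ) (hs : 0 < s) (M : ℕ → ℝ)
    (hM : ∀ j, M j = (∑ t ∈ Finset.Icc 1 j, u t / gf κ e f t) / s)
    (G : ℝ) (hG : G = gf κ e f f) (Z : ℝ) (hZ : Z = x 0 / s + M N) (hZ0 : Z ≠ 0) :
    x N = G * s * Z ∧ (x 0 / x N) ^ 2 ≤ (x 0 / s) ^ 2 / Z ^ 2 ∧
    ∑ j ∈ Finset.range N, (x j / x N - if f ≤ j then 1 else 0) ^ 2 ≤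
      2 * (∑ j ∈ Finset.range f, gf κ e f j / G) * ((x 0 / s) ^ 2 / Z ^ 2) +
      2 * ((∑ j ∈ Finset.range f, gf κ e f j / G * (M j) ^ 2) / Z ^ 2) +
      (∑ j ∈ Finset.Ico f N, (M N - M j) ^ 2) / Z ^ 2 ∧
    ∑ j ∈ Finset.range N, (x (j + 1) / x N - x j / x N) ^ 2 ≤
      4 * (κ ^ 2 * ∑ j ∈ Finset.range f, gf κ e f j / G) * ((x 0 / s) ^ 2 / Z ^ 2) +
      4 * κ ^ 2 * ((∑ j ∈ Finset.range f, gf κ e f j / G * (M j) ^ 2) / Z ^ 2) +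
      2 * ((∑ t ∈ Finset.Icc 1 N, (u t / s) ^ 2) / G ^ 2 / Z ^ 2) := by
  have hG1 : 1 ≤ G := by rw [hG]; exact gf_one_le hκ f
  have hG0 : 0 < G := by linarith
  have hZ2 : 0 < Z ^ 2 := by positivity
  have hsol : ∀ j, j ≤ n → x j = gf κ e f j * s * (x 0 / s + M j) := by
    intro j hj
    rw [gf_solve hκ n x u hx j hj, hM]
    field_simp
  have hxN : x N = G * s * Z := by
    rw [hsol N hNn, gf_after N hfN, ← hG, ← hZ]
  have hxN0 : x N ≠ 0 := by rw [hxN]; positivity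
  have hlow : ∀ j, j < f → (x j / x N) ^ 2 ≤
      gf κ e f j / G * (2 * ((x 0 / s) ^ 2 / Z ^ 2) + 2 * ((M j) ^ 2 / Z ^ 2)) := by
    intro j hj
    have hh0 : 0 ≤ gf κ e f j / G := div_nonneg (gf_pos hκ j).le hG0.le
    have hh1 : gf κ e f j / G ≤ 1 := by
      rw [div_le_one hG0, hG]; exact gf_mono hκ hj.le
    have e1 : x j / x N = gf κ e f j / G * ((x 0 / s + M j) / Z) := by
      rw [hxN, hsol j (by omega)]; field_simp
    have e2 : 2 * ((x 0 / s) ^ 2 / Z ^ 2) + 2 * ((M j) ^ 2 / Z ^ 2) =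
      (2 * (x 0 / s) ^ 2 + 2 * (M j) ^ 2) / Z ^ 2 := by ring
    rw [e1, e2, mul_pow, div_pow (x 0 / s + M j)]
    have h3 : (x 0 / s + M j) ^ 2 ≤ 2 * (x 0 / s) ^ 2 + 2 * (M j) ^ 2 := by
      nlinarith [sq_nonneg (x 0 / s - M j)]
    have h4 : (gf κ e f j / G) ^ 2 ≤ gf κ e f j / G := by nlinarith
    gcongr
  refine ⟨hxN, ?_, ?_, ?_⟩
  · have e1 : (x 0 / x N) ^ 2 = (x 0 / s) ^ 2 / Z ^ 2 / G ^ 2 := by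
      rw [hxN]; field_simp
    rw [e1]
    exact div_le_self (by positivity) (one_le_pow₀ hG1)
  · rw [← Finset.sum_range_add_sum_Ico _ hfN]
    apply add_le_add
    · calc _ ≤ ∑ j ∈ Finset.range f, gf κ e f j / G *
            (2 * ((x 0 / s) ^ 2 / Z ^ 2) + 2 * ((M j) ^ 2 / Z ^ 2)) := by
            refine Finset.sum_le_sum fun j hj => ?_
            rw [Finset.mem_range] at hj
            rw [if_neg (by omega), sub_zero]
            exact hlow j hj
        _ = _ := by
            rw [Finset.sum_div, Finset.mul_sum, Finset.mul_sum, Finset.sum_mul,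
              ← Finset.sum_add_distrib]
            refine Finset.sum_congr rfl fun j _ => ?_
            ring
    · rw [Finset.sum_div]
      refine Finset.sum_le_sum fun j hj => ?_
      rw [Finset.mem_Ico] at hj
      rw [if_pos hj.1, hsol j (by omega), gf_after j hj.1, ← hG, hxN]
      apply le_of_eq
      have : x 0 / s + M j = Z - (M N - M j) := by rw [hZ]; ring
      rw [this]
      field_simp
      ring
  · have hstep : ∀ j ∈ Finset.range N, (x (j + 1) / x N - x j / x N) ^ 2 ≤
        2 * (if j < f then κ ^ 2 * (x j / x N) ^ 2 else 0) +
          2 * ((u (j + 1) / s) ^ 2 / G ^ 2 / Z ^ 2) := by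
      intro j hj
      rw [Finset.mem_range] at hj
      have e1 : x (j + 1) / x N - x j / x N =
          (coefB κ e f (j + 1) - 1) * (x j / x N) + u (j + 1) / x N := by
        rw [hx (j + 1) (by omega) (by omega), Nat.add_sub_cancel]; ring
      have e2 : (u (j + 1) / s) ^ 2 / G ^ 2 / Z ^ 2 = (u (j + 1) / x N) ^ 2 := by
        rw [hxN]; field_simp
      have e3 : ((coefB κ e f (j + 1) - 1) * (x j / x N)) ^ 2 ≤
          (if j < f then κ ^ 2 * (x j / x N) ^ 2 else 0) := by
        unfold coefB
        split_ifs with h1 h2 h3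
        · rw [mul_pow]; simp
        · omega
        · simp; positivity
        · simp
      rw [e1, e2]
      nlinarith [sq_nonneg ((coefB κ e f (j + 1) - 1) * (x j / x N) - u (j + 1) / x N)]
    refine (Finset.sum_le_sum hstep).trans ?_
    rw [Finset.sum_add_distrib]
    apply add_le_add
    · rw [← Finset.mul_sum, ← Finset.sum_range_add_sum_Ico _ hfN,
        Finset.sum_eq_zero (s := Finset.Ico f N), add_zero]
      · calc _ ≤ 2 * ∑ j ∈ Finset.range f, κ ^ 2 * (gf κ e f j / G *
            (2 * ((x 0 / s) ^ 2 / Z ^ 2) + 2 * ((M j) ^ 2 / Z ^ 2))) := by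
              gcongr with j hj
              rw [Finset.mem_range] at hj
              rw [if_pos hj]
              exact mul_le_mul_of_nonneg_left (hlow j hj) (sq_nonneg κ)
          _ = _ := by
            rw [Finset.sum_div, Finset.mul_sum, Finset.mul_sum, Finset.mul_sum, Finset.mul_sum,
              Finset.sum_mul, ← Finset.sum_add_distrib]
            refine Finset.sum_congr rfl fun j _ => ?_
            ring
      · intro j hj
        rw [Finset.mem_Ico] at hj
        rw [if_neg (by omega)]
    · rw [sum_shift (fun _ b => (u b / s) ^ 2) N, Finset.sum_div, Finset.sum_div, Finset.mul_sum]

section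
variable {c α re rf : ℝ}

lemma floor_lim (q : ℝ) (hq : 0 ≤ q) :
    Tendsto (fun n : ℕ => (⌊(n : ℝ) * q⌋₊ : ℝ) / n) atTop (nhds q) := by
  have := (tendsto_nat_floor_mul_div_atTop hq).comp (tendsto_natCast_atTop_atTop (R := ℝ))
  refine this.congr fun n => ?_
  simp [mul_comm]

lemma floor_mono {p q : ℝ} (h : p ≤ q) (n : ℕ) : ⌊(n : ℝ) * p⌋₊ ≤ ⌊(n : ℝ) * q⌋₊ :=
  Nat.floor_mono (by gcongr)

lemma floor_le_n {q : ℝ} (h : q ≤ 1) (n : ℕ) : ⌊(n : ℝ) * q⌋₊ ≤ n := by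
  have := floor_mono h n
  simpa using this

lemma kap_lim (hα : 0 < α) : Tendsto (fun n : ℕ => c * (n : ℝ) ^ (-α)) atTop (nhds 0) := by
  have := ((tendsto_rpow_neg_atTop hα).comp (tendsto_natCast_atTop_atTop (R := ℝ))).const_mul c
  simpa using this

lemma kap_grow (hc : 0 < c) (hα : α < 1) (b : ℕ → ℝ) (v : ℝ) (hv : 0 < v)
    (hb : Tendsto (fun n : ℕ => b n / n) atTop (nhds v)) :
    Tendsto (fun n : ℕ => c * (n : ℝ) ^ (-α) * b n) atTop atTop := by
  have h1 := (tendsto_rpow_atTop (sub_pos.2 hα)).comp (tendsto_natCast_atTop_atTop (R := ℝ))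
  have h2 := (h1.atTop_mul_pos hv hb).const_mul_atTop hc
  refine h2.congr' ?_
  filter_upwards [eventually_gt_atTop 0] with n hn
  have hn0 : (0 : ℝ) < n := by exact_mod_cast hn
  simp only [Function.comp]
  rw [sub_eq_add_neg, Real.rpow_add hn0, Real.rpow_one]
  field_simp

lemma gf_grow (hc : 0 < c) (hα : α < 1) (hre : 0 < re) (q : ℝ) (h1 : re < q) (h2 : q ≤ rf) :
    Tendsto (fun n : ℕ => gf (c * (n : ℝ) ^ (-α)) ⌊(n : ℝ) * re⌋₊ ⌊(n : ℝ) * rf⌋₊ ⌊(n : ℝ) * q⌋₊)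
      atTop atTop := by
  have h3 : Tendsto (fun n : ℕ => ((⌊(n : ℝ) * q⌋₊ : ℝ) - ⌊(n : ℝ) * re⌋₊) / n) atTop
      (nhds (q - re)) := by
    simp_rw [sub_div]
    exact (floor_lim q (by linarith)).sub (floor_lim re hre.le)
  have h4 := kap_grow hc hα _ _ (sub_pos.2 h1) h3
  refine tendsto_atTop_mono (fun n => ?_) h4
  have := gf_lower (κ := c * (n : ℝ) ^ (-α)) (e := ⌊(n : ℝ) * re⌋₊) (f := ⌊(n : ℝ) * rf⌋₊)
    (by positivity) ⌊(n : ℝ) * q⌋₊ (floor_mono h2 n)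
  linarith

lemma H_le {κ : ℝ} (hκ : 0 < κ) (e f : ℕ) :
    ∑ j ∈ Finset.range f, gf κ e f j / gf κ e f f ≤ f / gf κ e f f + 1 / κ := by
  have hG := gf_pos (e := e) (f := f) hκ.le f
  have h := gf_sum (e := e) (f := f) hκ.le f le_rfl
  rw [← Finset.sum_div, div_add_div _ _ hG.ne' hκ.ne', div_le_div_iff₀ hG (by positivity)]
  have : (∑ j ∈ Finset.range f, gf κ e f j) * κ ≤ f * κ + gf κ e f f := by linarith
  nlinarith

lemma H_lim1 (hc : 0 < c) (hα : α < 1) (hre : 0 < re) (href : re < rf) (r : ℝ) (hr : rf < r) :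
    Tendsto (fun n : ℕ => (∑ j ∈ Finset.range ⌊(n : ℝ) * rf⌋₊,
      gf (c * (n : ℝ) ^ (-α)) ⌊(n : ℝ) * re⌋₊ ⌊(n : ℝ) * rf⌋₊ j /
      gf (c * (n : ℝ) ^ (-α)) ⌊(n : ℝ) * re⌋₊ ⌊(n : ℝ) * rf⌋₊ ⌊(n : ℝ) * rf⌋₊) / ⌊(n : ℝ) * r⌋₊)
      atTop (nhds 0) := by
  have hG := gf_grow hc hα hre rf href le_rfl
  have hK := kap_grow hc hα (fun n => (⌊(n : ℝ) * r⌋₊ : ℝ)) r (by linarith)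
    (floor_lim r (by linarith))
  have hs := hG.inv_tendsto_atTop.add hK.inv_tendsto_atTop
  rw [add_zero] at hs
  refine squeeze_zero' ?_ ?_ hs
  · filter_upwards with n
    refine div_nonneg (Finset.sum_nonneg fun j _ => ?_) (Nat.cast_nonneg _)
    exact div_nonneg (gf_pos (by positivity) _).le (gf_pos (by positivity) _).le
  · filter_upwards [eventually_gt_atTop 0, hK.eventually_gt_atTop 0] with n hn hKn
    have hn0 : (0 : ℝ) < n := by exact_mod_cast hn
    have hκ : 0 < c * (n : ℝ) ^ (-α) := by positivity
    have hN : (0 : ℝ) < ⌊(n : ℝ) * r⌋₊ := (pos_iff_pos_of_mul_pos hKn).1 hκ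
    have hfN : (⌊(n : ℝ) * rf⌋₊ : ℝ) ≤ ⌊(n : ℝ) * r⌋₊ := by exact_mod_cast floor_mono hr.le n
    have hG0 := gf_pos (e := ⌊(n : ℝ) * re⌋₊) (f := ⌊(n : ℝ) * rf⌋₊) hκ.le ⌊(n : ℝ) * rf⌋₊
    simp only [Pi.inv_apply]
    refine (div_le_div_of_nonneg_right (H_le hκ _ _) hN.le).trans ?_
    rw [add_div]
    apply add_le_add
    · rw [div_div, ← one_div, div_le_div_iff₀ (by positivity) hG0]
      nlinarith
    · rw [div_div, one_div]

lemma H_lim2 (hc : 0 < c) (hα0 : 0 < α) (hα : α < 1) (hre : 0 < re) (href : re < rf) :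
    Tendsto (fun n : ℕ => (c * (n : ℝ) ^ (-α)) ^ 2 * (∑ j ∈ Finset.range ⌊(n : ℝ) * rf⌋₊,
      gf (c * (n : ℝ) ^ (-α)) ⌊(n : ℝ) * re⌋₊ ⌊(n : ℝ) * rf⌋₊ j /
      gf (c * (n : ℝ) ^ (-α)) ⌊(n : ℝ) * re⌋₊ ⌊(n : ℝ) * rf⌋₊ ⌊(n : ℝ) * rf⌋₊))
      atTop (nhds 0) := by
  have hk := kap_lim (c := c) hα0
  have h3 : Tendsto (fun n : ℕ => ((⌊(n : ℝ) * rf⌋₊ : ℝ) - ⌊(n : ℝ) * re⌋₊) / n) atTop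
      (nhds (rf - re)) := by
    simp_rw [sub_div]
    exact (floor_lim rf (by linarith)).sub (floor_lim re hre.le)
  have h4 := (hk.mul ((floor_lim rf (by linarith)).div h3 (by linarith))).add hk
  rw [zero_mul, zero_add] at h4
  refine squeeze_zero' ?_ ?_ h4
  · filter_upwards with n
    refine mul_nonneg (sq_nonneg _) (Finset.sum_nonneg fun j _ => ?_)
    exact div_nonneg (gf_pos (by positivity) _).le (gf_pos (by positivity) _).le
  · filter_upwards [eventually_gt_atTop 0, h3.eventually (lt_mem_nhds (sub_pos.2 href))] with n hn hd
    have hn0 : (0 : ℝ) < n := by exact_mod_cast hn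
    have hκ : 0 < c * (n : ℝ) ^ (-α) := by positivity
    have hd : (0 : ℝ) < (⌊(n : ℝ) * rf⌋₊ : ℝ) - ⌊(n : ℝ) * re⌋₊ := by
      by_contra hh
      linarith [div_nonpos_of_nonpos_of_nonneg (not_lt.1 hh) hn0.le]
    have hG0 := gf_pos (e := ⌊(n : ℝ) * re⌋₊) (f := ⌊(n : ℝ) * rf⌋₊) hκ.le ⌊(n : ℝ) * rf⌋₊
    have hGl := gf_lower (e := ⌊(n : ℝ) * re⌋₊) (f := ⌊(n : ℝ) * rf⌋₊) hκ.le
      ⌊(n : ℝ) * rf⌋₊ le_rfl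
    set κ := c * (n : ℝ) ^ (-α)
    set G := gf κ ⌊(n : ℝ) * re⌋₊ ⌊(n : ℝ) * rf⌋₊ ⌊(n : ℝ) * rf⌋₊
    refine (mul_le_mul_of_nonneg_left (H_le hκ _ _) (sq_nonneg _)).trans ?_
    rw [mul_add]
    apply add_le_add
    · simp only [Pi.div_apply]
      rw [div_div_div_cancel_right₀ hn0.ne', sq, mul_assoc]
      refine mul_le_mul_of_nonneg_left ?_ hκ.le
      rw [← mul_div_assoc, div_le_div_iff₀ hG0 hd]
      have : (0 : ℝ) ≤ (⌊(n : ℝ) * rf⌋₊ : ℝ) := Nat.cast_nonneg _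
      nlinarith
    · apply le_of_eq; field_simp

end

/-- The normalising scale. -/
noncomputable def sc {Ω : Type*} [MeasurableSpace Ω] (P : ℕ → Measure Ω)
    (σ : ℕ → ℕ → Ω → ℝ) (n : ℕ) : ℝ := Real.sqrt ((n : ℝ) * avgVar P σ n n)

lemma indic_sum (v : ℕ → ℝ) (k n : ℕ) (hk : k ≤ n) :
    ∑ t ∈ Finset.Icc 1 n, (if t ≤ k then 1 else 0) * v t = ∑ t ∈ Finset.Icc 1 k, v t := by
  simp_rw [ite_mul, one_mul, zero_mul]
  rw [← Finset.sum_filter]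
  congr 1
  ext t
  simp only [Finset.mem_filter, Finset.mem_Icc]
  omega

section
variable {Ω : Type*} [mΩ : MeasurableSpace Ω] {μ : Measure Ω} {F : ℕ → MeasurableSpace Ω}
    {σ ε : ℕ → Ω → ℝ} {n : ℕ}

lemma Shk.mom_eq (h : Shk μ F σ ε n) (w : ℕ → ℝ) (s : Finset ℕ) (hs : s ⊆ Finset.Icc 1 n) (S : ℝ) :
    Integrable (fun ω => ((∑ t ∈ s, w t * (σ t ω * ε t ω)) / S) ^ 2) μ ∧
      ∫ ω, ((∑ t ∈ s, w t * (σ t ω * ε t ω)) / S) ^ 2 ∂μ =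
        (∑ t ∈ s, (w t) ^ 2 * ∫ ω, (σ t ω) ^ 2 ∂μ) / S ^ 2 := by
  obtain ⟨h1, h2⟩ := h.sum_sq w s hs
  simp_rw [div_pow]
  exact ⟨h1.div_const _, by rw [integral_div, h2]⟩

lemma Shk.mom (h : Shk μ F σ ε n) (w : ℕ → ℝ) (s : Finset ℕ) (hs : s ⊆ Finset.Icc 1 n) (S C : ℝ)
    (hS : 0 < S) (hw : ∀ t ∈ s, (w t) ^ 2 ≤ C) (hC : 0 ≤ C)
    (hsum : ∑ t ∈ Finset.Icc 1 n, ∫ ω, (σ t ω) ^ 2 ∂μ = S ^ 2) :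
    Integrable (fun ω => ((∑ t ∈ s, w t * (σ t ω * ε t ω)) / S) ^ 2) μ ∧
      ∫ ω, ((∑ t ∈ s, w t * (σ t ω * ε t ω)) / S) ^ 2 ∂μ ≤ C := by
  obtain ⟨h1, h2⟩ := h.mom_eq w s hs S
  refine ⟨h1, ?_⟩
  have hv : ∀ t, 0 ≤ ∫ ω, (σ t ω) ^ 2 ∂μ := fun t => integral_nonneg fun ω => sq_nonneg _
  rw [h2, div_le_iff₀ (by positivity), ← hsum, Finset.mul_sum]
  calc _ ≤ ∑ t ∈ s, C * ∫ ω, (σ t ω) ^ 2 ∂μ :=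
        Finset.sum_le_sum fun t ht => mul_le_mul_of_nonneg_right (hw t ht) (hv t)
    _ ≤ _ := Finset.sum_le_sum_of_subset_of_nonneg hs fun t _ _ => mul_nonneg hC (hv t)

lemma Shk.rem (h : Shk μ F σ ε n) (κ : ℝ) (hκ : 0 ≤ κ) (e f N k : ℕ) (hek : e ≤ k) (hkf : k ≤ f)
    (hfN : f ≤ N) (hNn : N ≤ n) (S : ℝ) (hS : 0 < S)
    (hsum : ∑ t ∈ Finset.Icc 1 n, ∫ ω, (σ t ω) ^ 2 ∂μ = S ^ 2) :
    ∫ ω, ((∑ t ∈ Finset.Icc 1 N, (1 / gf κ e f t - if t ≤ e then 1 else 0) *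
        (σ t ω * ε t ω)) / S) ^ 2 ∂μ ≤
      κ ^ 2 + ((∑ t ∈ Finset.Icc 1 k, ∫ ω, (σ t ω) ^ 2 ∂μ) / S ^ 2
        - (∑ t ∈ Finset.Icc 1 e, ∫ ω, (σ t ω) ^ 2 ∂μ) / S ^ 2) + ((gf κ e f k)⁻¹) ^ 2 := by
  have hsub : Finset.Icc 1 N ⊆ Finset.Icc 1 n := Finset.Icc_subset_Icc_right hNn
  rw [(h.mom_eq (fun t => 1 / gf κ e f t - if t ≤ e then 1 else 0) _ hsub S).2]
  have hv : ∀ t, 0 ≤ ∫ ω, (σ t ω) ^ 2 ∂μ := fun t => integral_nonneg fun ω => sq_nonneg _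
  set v : ℕ → ℝ := fun t => ∫ ω, (σ t ω) ^ 2 ∂μ with hvdef
  have hw : ∀ t, 1 ≤ t → (1 / gf κ e f t - if t ≤ e then 1 else 0) ^ 2 ≤
      κ ^ 2 + ((if t ≤ k then 1 else 0) - (if t ≤ e then 1 else 0)) + ((gf κ e f k)⁻¹) ^ 2 := by
    intro t ht
    have hi0 : 0 ≤ ((gf κ e f k)⁻¹) ^ 2 := sq_nonneg _
    have hg1 := gf_one_le (e := e) (f := f) hκ t
    have hg0 := gf_pos (e := e) (f := f) hκ t
    have hgk := gf_pos (e := e) (f := f) hκ k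
    rcases lt_trichotomy t e with hte | hte | hte
    · rw [gf_before t hte, if_pos hte.le, if_pos (by omega)]
      nlinarith [sq_nonneg κ]
    · obtain ⟨m, rfl⟩ : ∃ m, t = m + 1 := ⟨t - 1, by omega⟩
      have : gf κ e f (m + 1) = 1 + κ := by
        rw [gf_succ, gf_before m (by omega), coefB, if_pos ⟨by omega, by omega⟩, mul_one]
      rw [this, if_pos hte.le, if_pos (by omega)]
      have e1 : 1 / (1 + κ) - 1 = - (κ / (1 + κ)) := by field_simp; ring
      have e2 : κ / (1 + κ) ≤ κ := div_le_self hκ (by linarith)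
      have e3 : 0 ≤ κ / (1 + κ) := by positivity
      rw [e1]
      nlinarith
    · rw [if_neg (by omega : ¬ t ≤ e), sub_zero, sub_zero, one_div]
      split_ifs with htk
      · have : (gf κ e f t)⁻¹ ≤ 1 := inv_le_one_of_one_le₀ hg1
        have : 0 < (gf κ e f t)⁻¹ := by positivity
        nlinarith [sq_nonneg κ]
      · have : (gf κ e f t)⁻¹ ≤ (gf κ e f k)⁻¹ := by
          gcongr
          exact gf_mono hκ (by omega)
        have : ((gf κ e f t)⁻¹) ^ 2 ≤ ((gf κ e f k)⁻¹) ^ 2 := by gcongr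
        nlinarith [sq_nonneg κ]
  have hS2 : 0 < S ^ 2 := by positivity
  rw [div_le_iff₀ hS2]
  calc _ ≤ ∑ t ∈ Finset.Icc 1 n, (1 / gf κ e f t - if t ≤ e then 1 else 0) ^ 2 * v t :=
        Finset.sum_le_sum_of_subset_of_nonneg hsub fun t _ _ => mul_nonneg (sq_nonneg _) (hv t)
    _ ≤ ∑ t ∈ Finset.Icc 1 n, (κ ^ 2 + ((if t ≤ k then 1 else 0) - (if t ≤ e then 1 else 0)) +
          ((gf κ e f k)⁻¹) ^ 2) * v t := Finset.sum_le_sum fun t ht =>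
          mul_le_mul_of_nonneg_right (hw t (Finset.mem_Icc.1 ht).1) (hv t)
    _ = κ ^ 2 * S ^ 2 + (∑ t ∈ Finset.Icc 1 k, v t - ∑ t ∈ Finset.Icc 1 e, v t)
          + ((gf κ e f k)⁻¹) ^ 2 * S ^ 2 := by
        simp_rw [add_mul, sub_mul]
        rw [Finset.sum_add_distrib, Finset.sum_add_distrib, Finset.sum_sub_distrib,
          indic_sum v k n (by omega), indic_sum v e n (by omega), ← Finset.mul_sum,
          ← Finset.mul_sum, hsum]
    _ = _ := by field_simp

end

section
variable {Ω : Type*} [mΩ : MeasurableSpace Ω] {P : ℕ → Measure Ω} {F : ℕ → ℕ → MeasurableSpace Ω}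
    {σ ε : ℕ → ℕ → Ω → ℝ}

lemma sc_sq (h : ∀ n, Shk (P n) (F n) (σ n) (ε n) n)
    (hpos : ∀ n t, 1 ≤ t → t ≤ n → ∀ ω, 0 < σ n t ω) (n : ℕ) (hn : 1 ≤ n) :
    0 < sc P σ n ∧ ∑ t ∈ Finset.Icc 1 n, ∫ ω, (σ n t ω) ^ 2 ∂(P n) = (sc P σ n) ^ 2 ∧
      0 < avgVar P σ n n := by
  have hn0 : (0 : ℝ) < n := by exact_mod_cast hn
  have hv : ∀ t ∈ Finset.Icc 1 n, 0 < ∫ ω, (σ n t ω) ^ 2 ∂(P n) := by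
    intro t ht
    rw [Finset.mem_Icc] at ht
    have := (h n).prob
    rw [integral_pos_iff_support_of_nonneg (fun ω => sq_nonneg _) ((h n).σint t ht.1 ht.2)]
    have e : Function.support (fun ω => (σ n t ω) ^ 2) = Set.univ := by
      ext ω
      simp [(hpos n t ht.1 ht.2 ω).ne']
    rw [e]; simp
  have hs : 0 < ∑ t ∈ Finset.Icc 1 n, ∫ ω, (σ n t ω) ^ 2 ∂(P n) :=
    Finset.sum_pos hv ⟨1, by simp [hn]⟩
  have e : (n : ℝ) * avgVar P σ n n = ∑ t ∈ Finset.Icc 1 n, ∫ ω, (σ n t ω) ^ 2 ∂(P n) := by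
    rw [avgVar]; field_simp
  refine ⟨?_, ?_, ?_⟩
  · rw [sc, e]; exact Real.sqrt_pos.2 hs
  · rw [sc, e, Real.sq_sqrt hs.le]
  · rw [avgVar]; positivity

lemma avg_lim (hA2 : ∃ ζ ∈ Set.Ioo (0 : ℝ) 1, ∃ g : ℕ → ℝ,
      g =o[atTop] (fun n : ℕ => (n : ℝ) ^ (-(1 : ℝ) / 2)) ∧
      ∀ n t : ℕ, (n : ℝ) ^ ζ < (t : ℝ) → t ≤ n →
        |avgVar P σ n t / avgVar P σ n n - 1| ≤ g n) (q : ℝ) (hq : 0 < q) (hq1 : q ≤ 1) :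
    Tendsto (fun n : ℕ => avgVar P σ n ⌊(n : ℝ) * q⌋₊ / avgVar P σ n n) atTop (nhds 1) := by
  obtain ⟨ζ, hζ, g, hg, hb⟩ := hA2
  have h1 : Tendsto (fun n : ℕ => (n : ℝ) ^ (-(1 : ℝ) / 2)) atTop (nhds 0) := by
    have := (tendsto_rpow_neg_atTop (show (0 : ℝ) < 1 / 2 by norm_num)).comp
      (tendsto_natCast_atTop_atTop (R := ℝ))
    refine this.congr fun n => ?_
    simp [neg_div]
  have hg0 : Tendsto g atTop (nhds 0) := hg.isBigO.trans_tendsto h1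
  have h2 : Tendsto (fun n : ℕ => (n : ℝ) ^ (-(1 - ζ))) atTop (nhds 0) :=
    (tendsto_rpow_neg_atTop (sub_pos.2 hζ.2)).comp (tendsto_natCast_atTop_atTop (R := ℝ))
  have h3 := h2.eventually_lt (floor_lim q hq.le) hq
  rw [tendsto_iff_norm_sub_tendsto_zero]
  refine squeeze_zero' (Eventually.of_forall fun n => norm_nonneg _) ?_ hg0
  filter_upwards [h3, eventually_gt_atTop 0] with n hn hn1
  have hn0 : (0 : ℝ) < n := by exact_mod_cast hn1
  refine hb n _ ?_ (floor_le_n hq1 n)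
  rw [lt_div_iff₀ hn0] at hn
  have e : -(1 - ζ) + 1 = ζ := by ring
  rwa [← Real.rpow_add_one hn0.ne', e] at hn

lemma ratio_lim (h : ∀ n, Shk (P n) (F n) (σ n) (ε n) n)
    (hpos : ∀ n t, 1 ≤ t → t ≤ n → ∀ ω, 0 < σ n t ω)
    (hA2 : ∃ ζ ∈ Set.Ioo (0 : ℝ) 1, ∃ g : ℕ → ℝ,
      g =o[atTop] (fun n : ℕ => (n : ℝ) ^ (-(1 : ℝ) / 2)) ∧
      ∀ n t : ℕ, (n : ℝ) ^ ζ < (t : ℝ) → t ≤ n →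
        |avgVar P σ n t / avgVar P σ n n - 1| ≤ g n) (q : ℝ) (hq : 0 < q) (hq1 : q ≤ 1) :
    Tendsto (fun n : ℕ => (∑ t ∈ Finset.Icc 1 ⌊(n : ℝ) * q⌋₊, ∫ ω, (σ n t ω) ^ 2 ∂(P n)) /
      (sc P σ n) ^ 2) atTop (nhds q) := by
  have h1 := (floor_lim q hq.le).mul (avg_lim hA2 q hq hq1)
  rw [mul_one] at h1
  refine h1.congr' ?_
  filter_upwards [eventually_gt_atTop 0, (floor_lim q hq.le).eventually (lt_mem_nhds hq)]
    with n hn hk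
  have hn0 : (0 : ℝ) < n := by exact_mod_cast hn
  have hk0 : (⌊(n : ℝ) * q⌋₊ : ℝ) ≠ 0 := by
    intro h0
    rw [h0] at hk
    simp at hk
  obtain ⟨a1, a2, a3⟩ := sc_sq h hpos n hn
  have e : (sc P σ n) ^ 2 = n * avgVar P σ n n := by
    rw [sc, Real.sq_sqrt (by positivity)]
  rw [e]
  have e2 : ∑ t ∈ Finset.Icc 1 ⌊(n : ℝ) * q⌋₊, ∫ ω, (σ n t ω) ^ 2 ∂(P n) =
      ⌊(n : ℝ) * q⌋₊ * avgVar P σ n ⌊(n : ℝ) * q⌋₊ := by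
    rw [avgVar]; field_simp
  rw [e2, div_mul_div_comm]

lemma V_lim (h : ∀ n, Shk (P n) (F n) (σ n) (ε n) n)
    (hpos : ∀ n t, 1 ≤ t → t ≤ n → ∀ ω, 0 < σ n t ω)
    (hA1 : ∀ r ∈ Set.Ioc (0 : ℝ) 1, ∀ εp : ℝ, 0 < εp →
      Tendsto (fun n : ℕ => P n {ω |
          εp ≤ |(∑ t ∈ Finset.Icc 1 ⌊(n : ℝ) * r⌋₊, (σ n t ω) ^ 2) /
            ((⌊(n : ℝ) * r⌋₊ : ℝ) * avgVar P σ n ⌊(n : ℝ) * r⌋₊) - 1|})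
        atTop (nhds 0))
    (hA2 : ∃ ζ ∈ Set.Ioo (0 : ℝ) 1, ∃ g : ℕ → ℝ,
      g =o[atTop] (fun n : ℕ => (n : ℝ) ^ (-(1 : ℝ) / 2)) ∧
      ∀ n t : ℕ, (n : ℝ) ^ ζ < (t : ℝ) → t ≤ n →
        |avgVar P σ n t / avgVar P σ n n - 1| ≤ g n) (q : ℝ) (hq : 0 < q) (hq1 : q ≤ 1) :
    Tendsto (fun p : ℕ × Ω => ∑ t ∈ Finset.Icc 1 ⌊(p.1 : ℝ) * q⌋₊, (σ p.1 t p.2 / sc P σ p.1) ^ 2)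
      (pfil P) (nhds q) := by
  have h1 := (pfil_tendsto_iff P (fun n ω => (∑ t ∈ Finset.Icc 1 ⌊(n : ℝ) * q⌋₊, (σ n t ω) ^ 2) /
            ((⌊(n : ℝ) * q⌋₊ : ℝ) * avgVar P σ n ⌊(n : ℝ) * q⌋₊)) 1).2 (hA1 q ⟨hq, hq1⟩)
  have h2 := ratio_lim h hpos hA2 q hq hq1
  have h3 := h1.mul (h2.comp (pfil_fst P))
  rw [one_mul] at h3
  refine h3.congr' ?_
  have ev : ∀ᶠ n : ℕ in atTop, (∑ t ∈ Finset.Icc 1 ⌊(n : ℝ) * q⌋₊, ∫ ω, (σ n t ω) ^ 2 ∂(P n)) /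
      (sc P σ n) ^ 2 ≠ 0 ∧ (⌊(n : ℝ) * q⌋₊ : ℝ) ≠ 0 := by
    filter_upwards [h2.eventually (lt_mem_nhds hq),
      (floor_lim q hq.le).eventually (lt_mem_nhds hq)] with n hn hk
    refine ⟨hn.ne', fun h0 => ?_⟩
    rw [h0] at hk
    simp at hk
  filter_upwards [(pfil_fst P).eventually ev] with p hp
  obtain ⟨n, ω⟩ := p
  obtain ⟨hp1, hk0⟩ := hp
  simp only at hp1 hk0
  simp only [Function.comp]
  have e2 : ⌊(n : ℝ) * q⌋₊ * avgVar P σ n ⌊(n : ℝ) * q⌋₊ =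
      ∑ t ∈ Finset.Icc 1 ⌊(n : ℝ) * q⌋₊, ∫ ω, (σ n t ω) ^ 2 ∂(P n) := by
    rw [avgVar]; field_simp
  rw [e2]
  simp_rw [div_pow]
  rw [← Finset.sum_div, div_mul_div_comm, mul_comm (∑ t ∈ _, ∫ ω, (σ n t ω) ^ 2 ∂(P n)),
    mul_div_mul_right]
  intro h0
  exact hp1 (by rw [h0, zero_div])

end

section
variable {Ω : Type*} [mΩ : MeasurableSpace Ω] {P : ℕ → Measure Ω} {F : ℕ → ℕ → MeasurableSpace Ω}
    {σ ε : ℕ → ℕ → Ω → ℝ}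

/-- The discounted normalised noise. -/
noncomputable def Mf (σ ε : ℕ → ℕ → Ω → ℝ) (κ : ℕ → ℝ) (e f : ℕ → ℕ) (s : ℕ → ℝ)
    (n j : ℕ) (ω : Ω) : ℝ :=
  (∑ t ∈ Finset.Icc 1 j, σ n t ω * ε n t ω / gf (κ n) (e n) (f n) t) / s n

lemma sqrt_lim {T : Type*} {L : Filter T} {g : T → ℝ} (h : Tendsto (fun x => (g x) ^ 2) L (nhds 0)) :
    Tendsto g L (nhds 0) := by
  have h1 := h.sqrt
  simp_rw [Real.sqrt_sq_eq_abs, Real.sqrt_zero] at h1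
  exact (tendsto_zero_iff_abs_tendsto_zero g).2 h1

lemma Mf_mom (h : ∀ n, Shk (P n) (F n) (σ n) (ε n) n) (κ : ℕ → ℝ) (hκ : ∀ n, 0 ≤ κ n)
    (e f : ℕ → ℕ) (s : ℕ → ℝ)
    (hs : ∀ n, 1 ≤ n → 0 < s n ∧ ∑ t ∈ Finset.Icc 1 n, ∫ ω, (σ n t ω) ^ 2 ∂(P n) = (s n) ^ 2)
    (n : ℕ) (hn : 1 ≤ n) (j : ℕ) (hj : j ≤ n) :
    Integrable (fun ω => (Mf σ ε κ e f s n j ω) ^ 2) (P n) ∧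
      ∫ ω, (Mf σ ε κ e f s n j ω) ^ 2 ∂(P n) ≤ 1 := by
  have := (h n).mom (fun t => (gf (κ n) (e n) (f n) t)⁻¹) (Finset.Icc 1 j)
    (Finset.Icc_subset_Icc_right hj) (s n) 1 (hs n hn).1 (fun t _ => by
      have h1 := gf_one_le (e := e n) (f := f n) (hκ n) t
      exact pow_le_one₀ (by positivity) (inv_le_one_of_one_le₀ h1)) zero_le_one (hs n hn).2
  simp_rw [Mf, div_eq_inv_mul (_ * _)]
  exact this

lemma Mf_diff (h : ∀ n, Shk (P n) (F n) (σ n) (ε n) n) (κ : ℕ → ℝ) (hκ : ∀ n, 0 ≤ κ n)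
    (e f : ℕ → ℕ) (s : ℕ → ℝ)
    (hs : ∀ n, 1 ≤ n → 0 < s n ∧ ∑ t ∈ Finset.Icc 1 n, ∫ ω, (σ n t ω) ^ 2 ∂(P n) = (s n) ^ 2)
    (n : ℕ) (hn : 1 ≤ n) (j N : ℕ) (hfj : f n ≤ j) (hjN : j ≤ N) (hN : N ≤ n) :
    Integrable (fun ω => (Mf σ ε κ e f s n N ω - Mf σ ε κ e f s n j ω) ^ 2) (P n) ∧
      ∫ ω, (Mf σ ε κ e f s n N ω - Mf σ ε κ e f s n j ω) ^ 2 ∂(P n) ≤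
        ((gf (κ n) (e n) (f n) (f n))⁻¹) ^ 2 := by
  have := (h n).mom (fun t => (gf (κ n) (e n) (f n) t)⁻¹) (Finset.Ioc j N)
    (fun t ht => by rw [Finset.mem_Ioc] at ht; rw [Finset.mem_Icc]; omega) (s n)
    (((gf (κ n) (e n) (f n) (f n))⁻¹) ^ 2) (hs n hn).1 (fun t ht => by
      rw [Finset.mem_Ioc] at ht
      rw [gf_after t (by omega)]) (sq_nonneg _) (hs n hn).2
  have e1 : ∀ ω, Mf σ ε κ e f s n N ω - Mf σ ε κ e f s n j ω =
      (∑ t ∈ Finset.Ioc j N, (gf (κ n) (e n) (f n) t)⁻¹ * (σ n t ω * ε n t ω)) / s n := by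
    intro ω
    rw [Mf, Mf, ← sub_div]
    congr 1
    rw [sub_eq_iff_eq_add, add_comm]
    simp_rw [div_eq_inv_mul (_ * _)]
    have e2 : ∀ m, Finset.Icc 1 m = Finset.Ioc 0 m := fun m => by
      ext t; simp only [Finset.mem_Icc, Finset.mem_Ioc]; omega
    rw [e2, e2]
    exact (Finset.sum_Ioc_consecutive _ (Nat.zero_le j) hjN).symm
  simp_rw [e1]
  exact this

lemma main_lemma (h : ∀ n, Shk (P n) (F n) (σ n) (ε n) n) (X : ℕ → ℕ → Ω → ℝ)
    (κ : ℕ → ℝ) (hκ : ∀ n, 0 ≤ κ n) (hκ0 : Tendsto κ atTop (nhds 0))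
    (e f N : ℕ → ℕ) (hfN : ∀ n, f n ≤ N n) (hNn : ∀ n, N n ≤ n)
    (hN1 : ∀ᶠ n in atTop, 1 ≤ N n)
    (s : ℕ → ℝ)
    (hs : ∀ n, 1 ≤ n → 0 < s n ∧ ∑ t ∈ Finset.Icc 1 n, ∫ ω, (σ n t ω) ^ 2 ∂(P n) = (s n) ^ 2)
    (hmodel : ∀ n t, 1 ≤ t → t ≤ n → ∀ ω,
      X n t ω = coefB (κ n) (e n) (f n) t * X n (t - 1) ω + σ n t ω * ε n t ω)
    (G : ℕ → ℝ) (hGd : ∀ n, G n = gf (κ n) (e n) (f n) (f n))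
    (hG : Tendsto G atTop atTop)
    (H : ℕ → ℝ) (hHd : ∀ n, H n = ∑ j ∈ Finset.range (f n), gf (κ n) (e n) (f n) j / G n)
    (hH1 : Tendsto (fun n => H n / N n) atTop (nhds 0))
    (hH2 : Tendsto (fun n => (κ n) ^ 2 * H n) atTop (nhds 0))
    (hB : Tendsto (fun p : ℕ × Ω => X p.1 0 p.2 / s p.1) (pfil P) (nhds 0))
    (hZ : AntiConc P (fun n ω => X n 0 ω / s n + Mf σ ε κ e f s n (N n) ω))
    (a : ℝ) (ha0 : 0 < a) (ha1 : a < 1)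
    (hβ : Tendsto (fun n => ((N n : ℝ) - f n) / N n) atTop (nhds a)) :
    Tendsto (fun p : ℕ × Ω => svadfDelta (X p.1) (N p.1) p.2) (pfil P)
      (nhds ((1 / 2 - a) / (a - a ^ 2))) := by
  have hGi : Tendsto (fun n => ((G n)⁻¹) ^ 2) atTop (nhds 0) := by
    simpa using hG.inv_tendsto_atTop.pow 2
  have hGpos : ∀ n, 0 < G n := fun n => by rw [hGd]; exact gf_pos (hκ n) _
  have hgG : ∀ n j, 0 ≤ gf (κ n) (e n) (f n) j / G n := fun n j =>
    div_nonneg (gf_pos (hκ n) _).le (hGpos n).le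
  -- the weighted noise
  let A : ℕ → Ω → ℝ := fun n ω =>
    ∑ j ∈ Finset.range (f n), gf (κ n) (e n) (f n) j / G n * (Mf σ ε κ e f s n j ω) ^ 2
  have hA0 : ∀ n ω, 0 ≤ A n ω := fun n ω =>
    Finset.sum_nonneg fun j _ => mul_nonneg (hgG n j) (sq_nonneg _)
  have hAi : ∀ n, 1 ≤ n → Integrable (A n) (P n) ∧ ∫ ω, A n ω ∂(P n) ≤ H n := by
    intro n hn
    have hm : ∀ j ∈ Finset.range (f n), Integrable (fun ω => gf (κ n) (e n) (f n) j / G n *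
        (Mf σ ε κ e f s n j ω) ^ 2) (P n) := by
      intro j hj
      rw [Finset.mem_range] at hj
      exact (Mf_mom h κ hκ e f s hs n hn j (by have := hfN n; have := hNn n; omega)).1.const_mul _
    refine ⟨integrable_finsetSum _ hm, ?_⟩
    simp only [A]
    rw [integral_finsetSum _ hm, hHd]
    refine Finset.sum_le_sum fun j hj => ?_
    rw [Finset.mem_range] at hj
    rw [integral_const_mul]
    exact mul_le_of_le_one_right (hgG n j)
      (Mf_mom h κ hκ e f s hs n hn j (by have := hfN n; have := hNn n; omega)).2
  have ta : Tendsto (fun p : ℕ × Ω => A p.1 p.2 / N p.1) (pfil P) (nhds 0) := by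
    refine pfil_markov P (fun n ω => A n ω / N n) _ hH1 ?_
    filter_upwards [eventually_ge_atTop 1] with n hn
    refine ⟨fun ω => div_nonneg (hA0 n ω) (Nat.cast_nonneg _), (hAi n hn).1.div_const _, ?_⟩
    rw [integral_div]
    exact div_le_div_of_nonneg_right (hAi n hn).2 (Nat.cast_nonneg _)
  have tb : Tendsto (fun p : ℕ × Ω => (κ p.1) ^ 2 * A p.1 p.2) (pfil P) (nhds 0) := by
    refine pfil_markov P (fun n ω => (κ n) ^ 2 * A n ω) _ hH2 ?_
    filter_upwards [eventually_ge_atTop 1] with n hn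
    refine ⟨fun ω => mul_nonneg (sq_nonneg _) (hA0 n ω), (hAi n hn).1.const_mul _, ?_⟩
    rw [integral_const_mul]
    exact mul_le_mul_of_nonneg_left (hAi n hn).2 (sq_nonneg _)
  let C : ℕ → Ω → ℝ := fun n ω =>
    ∑ j ∈ Finset.Ico (f n) (N n), (Mf σ ε κ e f s n (N n) ω - Mf σ ε κ e f s n j ω) ^ 2
  have tc : Tendsto (fun p : ℕ × Ω => C p.1 p.2 / N p.1) (pfil P) (nhds 0) := by
    refine pfil_markov P (fun n ω => C n ω / N n) _ hGi ?_
    filter_upwards [eventually_ge_atTop 1, hN1] with n hn hN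
    have hN0 : (0 : ℝ) < N n := by exact_mod_cast hN
    have hm : ∀ j ∈ Finset.Ico (f n) (N n), Integrable (fun ω =>
        (Mf σ ε κ e f s n (N n) ω - Mf σ ε κ e f s n j ω) ^ 2) (P n) := by
      intro j hj
      rw [Finset.mem_Ico] at hj
      exact (Mf_diff h κ hκ e f s hs n hn j (N n) hj.1 hj.2.le (hNn n)).1
    refine ⟨fun ω => div_nonneg (Finset.sum_nonneg fun j _ => sq_nonneg _) hN0.le,
      (integrable_finsetSum _ hm).div_const _, ?_⟩
    rw [integral_div, div_le_iff₀ hN0]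
    simp only [C]
    rw [integral_finsetSum _ hm]
    calc _ ≤ ∑ j ∈ Finset.Ico (f n) (N n), ((G n)⁻¹) ^ 2 := by
          refine Finset.sum_le_sum fun j hj => ?_
          rw [Finset.mem_Ico] at hj
          rw [hGd]
          exact (Mf_diff h κ hκ e f s hs n hn j (N n) hj.1 hj.2.le (hNn n)).2
      _ ≤ _ := by
          rw [Finset.sum_const, Nat.card_Ico, nsmul_eq_mul, mul_comm]
          gcongr
          omega
  let U : ℕ → Ω → ℝ := fun n ω =>
    (∑ t ∈ Finset.Icc 1 (N n), (σ n t ω * ε n t ω / s n) ^ 2) / (G n) ^ 2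
  have td : Tendsto (fun p : ℕ × Ω => U p.1 p.2) (pfil P) (nhds 0) := by
    refine pfil_markov P U _ hGi ?_
    filter_upwards [eventually_ge_atTop 1] with n hn
    obtain ⟨hs0, hs2⟩ := hs n hn
    have hm : ∀ t ∈ Finset.Icc 1 (N n), Integrable (fun ω =>
        (σ n t ω * ε n t ω / s n) ^ 2) (P n) := by
      intro t ht
      rw [Finset.mem_Icc] at ht
      simp_rw [div_pow]
      exact ((h n).u_sq ht.1 (ht.2.trans (hNn n))).1.div_const _
    refine ⟨fun ω => div_nonneg (Finset.sum_nonneg fun j _ => sq_nonneg _) (sq_nonneg _),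
      (integrable_finsetSum _ hm).div_const _, ?_⟩
    simp only [U]
    rw [integral_div, integral_finsetSum _ hm, inv_pow, ← one_div]
    refine div_le_div_of_nonneg_right ?_ (sq_nonneg _)
    calc _ = ∑ t ∈ Finset.Icc 1 (N n), (∫ ω, (σ n t ω) ^ 2 ∂(P n)) / (s n) ^ 2 := by
          refine Finset.sum_congr rfl fun t ht => ?_
          rw [Finset.mem_Icc] at ht
          simp_rw [div_pow]
          rw [integral_div, ((h n).u_sq ht.1 (ht.2.trans (hNn n))).2]
      _ ≤ ∑ t ∈ Finset.Icc 1 n, (∫ ω, (σ n t ω) ^ 2 ∂(P n)) / (s n) ^ 2 :=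
          Finset.sum_le_sum_of_subset_of_nonneg (Finset.Icc_subset_Icc_right (hNn n))
            fun t _ _ => div_nonneg (integral_nonneg fun ω => sq_nonneg _) (sq_nonneg _)
      _ = 1 := by
          rw [← Finset.sum_div, hs2]
          exact div_self (by positivity)
  let Z : ℕ → Ω → ℝ := fun n ω => X n 0 ω / s n + Mf σ ε κ e f s n (N n) ω
  have hB2 : Tendsto (fun p : ℕ × Ω => (X p.1 0 p.2 / s p.1) ^ 2) (pfil P) (nhds 0) := by
    simpa using hB.pow 2
  have da := hZ.div (R := fun n ω => A n ω / N n) ta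
  have db := hZ.div (R := fun n ω => (κ n) ^ 2 * A n ω) tb
  have dc := hZ.div (R := fun n ω => C n ω / N n) tc
  have dd := hZ.div (R := U) td
  have dB := hZ.div (R := fun n ω => (X n 0 ω / s n) ^ 2) hB2
  have hfst := pfil_fst P
  have evn := hfst.eventually (hN1.and (eventually_ge_atTop 1))
  -- the paths
  let y : ℕ → Ω → ℕ → ℝ := fun n ω j => X n j ω / X n (N n) ω
  let W : ℕ → Ω → ℝ := fun n ω =>
    (∑ j ∈ Finset.range (N n), (y n ω j - if f n ≤ j then 1 else 0) ^ 2) / N n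
  let D : ℕ → Ω → ℝ := fun n ω => ∑ j ∈ Finset.range (N n), (y n ω (j + 1) - y n ω j) ^ 2
  let S1 : ℕ → Ω → ℝ := fun n ω => (∑ j ∈ Finset.range (N n), y n ω j) / N n
  let S2 : ℕ → Ω → ℝ := fun n ω => (∑ j ∈ Finset.range (N n), (y n ω j) ^ 2) / N n
  have path : ∀ n ω, 1 ≤ n → Z n ω ≠ 0 → _ := fun n ω hn hz =>
    path_bounds (κ n) (hκ n) (e n) (f n) (N n) n (hfN n) (hNn n) (fun j => X n j ω)
      (fun t => σ n t ω * ε n t ω) (fun t h1 h2 => hmodel n t h1 h2 ω) (s n) (hs n hn).1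
      (fun j => Mf σ ε κ e f s n j ω) (fun j => rfl) (G n) (hGd n) (Z n ω) rfl hz
  have tW : Tendsto (fun p : ℕ × Ω => W p.1 p.2) (pfil P) (nhds 0) := by
    have l1 := ((((hH1.comp hfst).const_mul 2).mul dB).add (da.const_mul 2)).add dc
    simp only [mul_zero, add_zero] at l1
    refine squeeze_zero' (Eventually.of_forall fun p => by positivity) ?_ l1
    filter_upwards [evn, hZ.ne_zero] with p hp hz
    have hN0 : (0 : ℝ) < N p.1 := by exact_mod_cast hp.1
    obtain ⟨-, -, q3, -⟩ := path p.1 p.2 hp.2 hz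
    rw [← hHd] at q3
    simp only [W, y]
    refine (div_le_div_of_nonneg_right q3 hN0.le).trans (le_of_eq ?_)
    simp only [A, C, Z, Function.comp]
    ring
  have tD : Tendsto (fun p : ℕ × Ω => D p.1 p.2) (pfil P) (nhds 0) := by
    have l1 := ((((hH2.comp hfst).const_mul 4).mul dB).add (db.const_mul 4)).add (dd.const_mul 2)
    simp only [mul_zero, add_zero] at l1
    refine squeeze_zero' (Eventually.of_forall fun p => by positivity) ?_ l1
    filter_upwards [evn, hZ.ne_zero] with p hp hz
    obtain ⟨-, -, -, q4⟩ := path p.1 p.2 hp.2 hz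
    rw [← hHd] at q4
    refine q4.trans (le_of_eq ?_)
    simp only [A, U, Z, Function.comp]
    ring
  have ty : Tendsto (fun p : ℕ × Ω => y p.1 p.2 0) (pfil P) (nhds 0) := by
    apply sqrt_lim
    refine squeeze_zero' (Eventually.of_forall fun p => by positivity) ?_ dB
    filter_upwards [evn, hZ.ne_zero] with p hp hz
    exact (path p.1 p.2 hp.2 hz).2.1
  have hsW : Tendsto (fun p : ℕ × Ω => √(W p.1 p.2)) (pfil P) (nhds 0) := by
    simpa using tW.sqrt
  have hβ' := hβ.comp hfst
  have tS1 : Tendsto (fun p : ℕ × Ω => S1 p.1 p.2) (pfil P) (nhds a) := by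
    have : Tendsto (fun p : ℕ × Ω => S1 p.1 p.2 - ((N p.1 : ℝ) - f p.1) / N p.1) (pfil P)
        (nhds 0) := by
      apply squeeze_zero_norm' _ hsW
      filter_upwards [evn] with p hp
      exact (S_bounds (N p.1) (f p.1) hp.1 (hfN p.1) (y p.1 p.2) _ _ _ _ rfl rfl rfl rfl).1
    simpa using this.add hβ'
  have tS2 : Tendsto (fun p : ℕ × Ω => S2 p.1 p.2) (pfil P) (nhds a) := by
    have l := (hsW.const_mul 2).add tW
    simp only [mul_zero, add_zero] at l
    have : Tendsto (fun p : ℕ × Ω => S2 p.1 p.2 - ((N p.1 : ℝ) - f p.1) / N p.1) (pfil P)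
        (nhds 0) := by
      apply squeeze_zero_norm' _ l
      filter_upwards [evn] with p hp
      exact (S_bounds (N p.1) (f p.1) hp.1 (hfN p.1) (y p.1 p.2) _ _ _ _ rfl rfl rfl rfl).2
    simpa using this.add hβ'
  have tden := tS2.sub (tS1.pow 2)
  have hne : a - a ^ 2 ≠ 0 := by nlinarith
  have tnum := (((tendsto_const_nhds (x := (1 : ℝ))).sub (ty.pow 2)).sub tD).div_const 2 |>.sub
    (tS1.mul ((tendsto_const_nhds (x := (1 : ℝ))).sub ty))
  have tot := tnum.div tden hne
  have e0 : (((1 : ℝ) - 0 ^ 2 - 0) / 2 - a * (1 - 0)) / (a - a ^ 2) = (1 / 2 - a) / (a - a ^ 2) := by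
    ring
  rw [e0] at tot
  refine tot.congr' ?_
  filter_upwards [evn, hZ.ne_zero, tden.eventually_ne hne] with p hp hz hd
  have hX : X p.1 (N p.1) p.2 ≠ 0 := by
    have q := (path p.1 p.2 hp.2 hz).1
    rw [q]
    exact mul_ne_zero (mul_ne_zero (hGpos _).ne' (hs p.1 hp.2).1.ne') hz
  exact (svadf_formula (X p.1) (N p.1) hp.1 p.2 hX (y p.1 p.2) (fun j => rfl) _ _ _ rfl rfl rfl
    hd).symm

end

lemma rem_lim {Ω : Type*} [mΩ : MeasurableSpace Ω] {P : ℕ → Measure Ω}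
    {F : ℕ → ℕ → MeasurableSpace Ω} {σ ε : ℕ → ℕ → Ω → ℝ} {c α re rf : ℝ}
    (h : ∀ n, Shk (P n) (F n) (σ n) (ε n) n)
    (hpos : ∀ n t, 1 ≤ t → t ≤ n → ∀ ω, 0 < σ n t ω)
    (hA2 : ∃ ζ ∈ Set.Ioo (0 : ℝ) 1, ∃ g : ℕ → ℝ,
      g =o[atTop] (fun n : ℕ => (n : ℝ) ^ (-(1 : ℝ) / 2)) ∧
      ∀ n t : ℕ, (n : ℝ) ^ ζ < (t : ℝ) → t ≤ n →
        |avgVar P σ n t / avgVar P σ n n - 1| ≤ g n)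
    (hc : 0 < c) (hα0 : 0 < α) (hα : α < 1) (hre : 0 < re) (href : re < rf)
    (r : ℝ) (hr : rf < r) (hr1 : r ≤ 1) :
    Tendsto (fun p : ℕ × Ω => (∑ t ∈ Finset.Icc 1 ⌊(p.1 : ℝ) * r⌋₊,
      (1 / gf (c * (p.1 : ℝ) ^ (-α)) ⌊(p.1 : ℝ) * re⌋₊ ⌊(p.1 : ℝ) * rf⌋₊ t -
        if t ≤ ⌊(p.1 : ℝ) * re⌋₊ then 1 else 0) * (σ p.1 t p.2 * ε p.1 t p.2)) / sc P σ p.1)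
      (pfil P) (nhds 0) := by
  apply sqrt_lim
  let R : ℕ → Ω → ℝ := fun n ω => ((∑ t ∈ Finset.Icc 1 ⌊(n : ℝ) * r⌋₊,
      (1 / gf (c * (n : ℝ) ^ (-α)) ⌊(n : ℝ) * re⌋₊ ⌊(n : ℝ) * rf⌋₊ t -
        if t ≤ ⌊(n : ℝ) * re⌋₊ then 1 else 0) * (σ n t ω * ε n t ω)) / sc P σ n) ^ 2
  refine pfil_markov P R (fun n => ∫ ω, R n ω ∂(P n)) ?_ ?_
  · have hub : ∀ q, re < q → q ≤ rf → ∀ d, q - re < d →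
        ∀ᶠ n in atTop, ∫ ω, R n ω ∂(P n) < d := by
      intro q hq1 hq2 d hd
      have hi : Tendsto (fun n : ℕ => ((gf (c * (n : ℝ) ^ (-α)) ⌊(n : ℝ) * re⌋₊
          ⌊(n : ℝ) * rf⌋₊ ⌊(n : ℝ) * q⌋₊)⁻¹) ^ 2) atTop (nhds 0) := by
        simpa using (gf_grow hc hα hre q hq1 hq2).inv_tendsto_atTop.pow 2
      have hl := (((kap_lim (c := c) hα0).pow 2).add
        ((ratio_lim h hpos hA2 q (by linarith) (by linarith)).sub
          (ratio_lim h hpos hA2 re hre (by linarith)))).add hi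
      have e0 : (0 : ℝ) ^ 2 + (q - re) + 0 = q - re := by ring
      rw [e0] at hl
      filter_upwards [hl.eventually_lt_const hd, eventually_ge_atTop 1] with n hn hn1
      obtain ⟨a1, a2, -⟩ := sc_sq h hpos n hn1
      refine lt_of_le_of_lt ?_ hn
      exact (h n).rem (c * (n : ℝ) ^ (-α)) (by positivity) _ _ _ ⌊(n : ℝ) * q⌋₊
        (floor_mono hq1.le n) (floor_mono hq2 n) (floor_mono hr.le n) (floor_le_n hr1 n) _ a1 a2
    rw [tendsto_order]
    constructor
    · intro b hb
      exact Eventually.of_forall fun n => lt_of_lt_of_le hb (integral_nonneg fun ω => sq_nonneg _)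
    · intro d hd
      refine hub (min rf (re + d / 2)) (lt_min href (by linarith)) (min_le_left _ _) d ?_
      have := min_le_right rf (re + d / 2)
      linarith
  · filter_upwards with n
    exact ⟨fun ω => sq_nonneg _, ((h n).mom_eq _ _
      (Finset.Icc_subset_Icc_right (floor_le_n hr1 n)) _).1, le_rfl⟩

/-- Post-collapse limit of the coefficient statistic (displayed limit in the proof of
Theorem 4): in the bubble model, under Assumptions A1, A2 and the initial-value
condition, for every fixed `r` with `r_f < r ≤ 1`, the coefficient statistic
`SV-ADF^δ_{⌊nr⌋}` converges in probability to the finite constant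
`r² (1/2 - a) / (r_f (r - r_f))` with `a = (r - r_f)/r`; in particular, beyond the
collapse date the statistic is bounded in probability rather than divergent. -/
theorem stmt17
    {Ω : Type*} [MeasurableSpace Ω]
    (P : ℕ → Measure Ω) (hP : ∀ n, IsProbabilityMeasure (P n))
    (ℱ : ℕ → ℕ → MeasurableSpace Ω) (hℱmono : ∀ n, Monotone (ℱ n))
    (hℱle : ∀ n t, ℱ n t ≤ ‹MeasurableSpace Ω›)
    (X σ ε : ℕ → ℕ → Ω → ℝ)
    (hX0meas : ∀ n, Measurable[ℱ n 0] (X n 0))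
    (hσpos : ∀ n t, 1 ≤ t → t ≤ n → ∀ ω, 0 < σ n t ω)
    (hσmeas : ∀ n t, 1 ≤ t → t ≤ n → Measurable[ℱ n (t - 1)] (σ n t))
    (hσint : ∀ n t, 1 ≤ t → t ≤ n → Integrable (fun ω => (σ n t ω) ^ 2) (P n))
    (hεmeas : ∀ n t, Measurable (ε n t))
    (hεgauss : ∀ n t, 1 ≤ t → t ≤ n → Measure.map (ε n t) (P n) = gaussianReal 0 1)
    (hεindep : ∀ n t, 1 ≤ t → t ≤ n →
      Indep (MeasurableSpace.comap (ε n t) inferInstance) (ℱ n (t - 1)) (P n))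
    (huadapted : ∀ n t, 1 ≤ t → t ≤ n →
      Measurable[ℱ n t] (fun ω => σ n t ω * ε n t ω))
    -- bubble model parameters
    (r0 re rf c α : ℝ)
    (hr0 : 0 < r0) (hr0e : r0 < re) (href : re < rf) (hrf1 : rf < 1)
    (hc : 0 < c) (hα : α ∈ Set.Ioo (0 : ℝ) 1)
    -- model equations
    (hmodel : ∀ n t, 1 ≤ t → t ≤ n → ∀ ω,
      X n t ω = (if ⌊(n : ℝ) * re⌋₊ ≤ t ∧ t ≤ ⌊(n : ℝ) * rf⌋₊
          then 1 + c * (n : ℝ) ^ (-α) else 1) * X n (t - 1) ω + σ n t ω * ε n t ω)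
    -- Assumption A1
    (hA1 : ∀ r ∈ Set.Ioc (0 : ℝ) 1, ∀ εp : ℝ, 0 < εp →
      Tendsto (fun n : ℕ => P n {ω |
          εp ≤ |(∑ t ∈ Finset.Icc 1 ⌊(n : ℝ) * r⌋₊, (σ n t ω) ^ 2) /
            ((⌊(n : ℝ) * r⌋₊ : ℝ) * avgVar P σ n ⌊(n : ℝ) * r⌋₊) - 1|})
        atTop (nhds 0))
    -- Assumption A2
    (hA2 : ∃ ζ ∈ Set.Ioo (0 : ℝ) 1, ∃ g : ℕ → ℝ,
      g =o[atTop] (fun n : ℕ => (n : ℝ) ^ (-(1 : ℝ) / 2)) ∧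
      ∀ n t : ℕ, (n : ℝ) ^ ζ < (t : ℝ) → t ≤ n →
        |avgVar P σ n t / avgVar P σ n n - 1| ≤ g n)
    -- initial-value condition
    (hinit : ∀ εp : ℝ, 0 < εp →
      Tendsto (fun n : ℕ => P n {ω |
          εp ≤ |X n 0 ω / Real.sqrt ((n : ℝ) * avgVar P σ n n)|})
        atTop (nhds 0))
    -- fixed fraction beyond the collapse date
    (r : ℝ) (hrfr : rf < r) (hr1 : r ≤ 1) :
    ∀ εp : ℝ, 0 < εp →
      Tendsto (fun n : ℕ => P n {ω |
          εp ≤ |svadfDelta (X n) ⌊(n : ℝ) * r⌋₊ ω -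
            r ^ 2 * (1 / 2 - (r - rf) / r) / (rf * (r - rf))|})
        atTop (nhds 0) := by
  have hsh : ∀ n, Shk (P n) (ℱ n) (σ n) (ε n) n := fun n =>
    { prob := hP n
      mono := hℱmono n
      le := hℱle n
      σmeas := hσmeas n
      σint := hσint n
      εmeas := hεmeas n
      gauss := hεgauss n
      indep := hεindep n
      adapted := huadapted n }
  have hre : 0 < re := by linarith
  have hsc := sc_sq hsh hσpos
  have hκ : ∀ n : ℕ, 0 ≤ c * (n : ℝ) ^ (-α) := fun n => by positivity
  have hG := gf_grow hc hα.2 hre rf href le_rfl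
  have hB : Tendsto (fun p : ℕ × Ω => X p.1 0 p.2 / sc P σ p.1) (pfil P) (nhds 0) := by
    refine (pfil_tendsto_iff P (fun n ω => X n 0 ω / sc P σ n) 0).2 fun e he => ?_
    simpa [sc] using hinit e he
  have hanti := clt_anti P ℱ σ ε hsh (fun n => ⌊(n : ℝ) * re⌋₊) (floor_le_n (by linarith))
    (sc P σ) re hre (V_lim hsh hσpos hA1 hA2 re hre (by linarith))
  have hR := rem_lim hsh hσpos hA2 hc hα.1 hα.2 hre href r hrfr hr1
  have hZ := hanti.add (R := fun n ω => X n 0 ω / sc P σ n + (∑ t ∈ Finset.Icc 1 ⌊(n : ℝ) * r⌋₊,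
    (1 / gf (c * (n : ℝ) ^ (-α)) ⌊(n : ℝ) * re⌋₊ ⌊(n : ℝ) * rf⌋₊ t -
      if t ≤ ⌊(n : ℝ) * re⌋₊ then 1 else 0) * (σ n t ω * ε n t ω)) / sc P σ n)
      (by simpa using hB.add hR)
  have hfl := floor_lim r (by linarith)
  have hN0 : ∀ᶠ n : ℕ in atTop, 1 ≤ ⌊(n : ℝ) * r⌋₊ := by
    filter_upwards [hfl.eventually (lt_mem_nhds (show 0 < r by linarith))] with n hn
    by_contra hh
    have : ⌊(n : ℝ) * r⌋₊ = 0 := by omega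
    rw [this] at hn
    simp at hn
  have hβ : Tendsto (fun n : ℕ => ((⌊(n : ℝ) * r⌋₊ : ℝ) - ⌊(n : ℝ) * rf⌋₊) / ⌊(n : ℝ) * r⌋₊) atTop
      (nhds ((r - rf) / r)) := by
    refine ((hfl.sub (floor_lim rf (by linarith))).div hfl (by linarith)).congr' ?_
    filter_upwards [eventually_gt_atTop 0] with n hn
    have hn0 : (n : ℝ) ≠ 0 := by exact_mod_cast hn.ne'
    simp only [Pi.div_apply]
    rw [← sub_div, div_div_div_cancel_right₀ hn0]
  have hr0 : 0 < r := by linarith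
  have hm := main_lemma hsh X (fun n : ℕ => c * (n : ℝ) ^ (-α)) hκ (kap_lim hα.1)
    (fun n => ⌊(n : ℝ) * re⌋₊) (fun n => ⌊(n : ℝ) * rf⌋₊) (fun n => ⌊(n : ℝ) * r⌋₊)
    (floor_mono hrfr.le) (floor_le_n hr1) hN0 (sc P σ) (fun n hn => ⟨(hsc n hn).1, (hsc n hn).2.1⟩)
    hmodel _ (fun n => rfl) hG _ (fun n => rfl) (H_lim1 hc hα.2 hre href r hrfr)
    (H_lim2 hc hα.1 hα.2 hre href) hB (by
      convert hZ using 3 with n ω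
      rw [Mf, add_left_comm]
      congr 1
      rw [← add_div]
      congr 1
      rw [← indic_sum (fun t => σ n t ω * ε n t ω) ⌊(n : ℝ) * re⌋₊ ⌊(n : ℝ) * r⌋₊
        (floor_mono (by linarith) n), ← Finset.sum_add_distrib]
      refine Finset.sum_congr rfl fun t _ => ?_
      ring) ((r - rf) / r) (div_pos (by linarith) hr0) (by rw [div_lt_one hr0]; linarith) hβ
  have hlim : (1 / 2 - (r - rf) / r) / ((r - rf) / r - ((r - rf) / r) ^ 2) =
      r ^ 2 * (1 / 2 - (r - rf) / r) / (rf * (r - rf)) := by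
    have h1 : (r - rf) ≠ 0 := by linarith
    have h2 : rf ≠ 0 := by linarith
    have e : (r - rf) / r - ((r - rf) / r) ^ 2 = rf * (r - rf) / r ^ 2 := by
      field_simp
      ring
    rw [e, div_div_eq_mul_div]
    ring
  rw [hlim] at hm
  exact (pfil_tendsto_iff P (fun n ω => svadfDelta (X n) ⌊(n : ℝ) * r⌋₊ ω) _).1 hm
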